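/- Let 0 < κ ≤ 1/12. There exist C > 0 and λ₀ > 0 (depending only on κ) such that for all 0 < λ ≤ λ₀, every η with λ^{2+4κ} ≤ η ≤ λ^{2+κ}, every α ∈ ℝ, and every C¹ function g : 𝕋³ → ℂ, one has |∫_{𝕋³} [ 1/(α − ω(p) + iη) − 1/(α − e(p) + iη) ] g(p) dp| ≤ C λ^{1−4κ} |log λ| ‖g‖_{C¹}. -/

import Mathlib

open MeasureTheory Filter Topology

noncomputable section

/-- The torus `𝕋³ = [-1/2, 1/2]³` realized as a box in `ℝ³`. -/
def T3 : Set (Fin 3 → ℝ) := Set.pi Set.univ fun _ => Set.Icc (-(1/2) : ℝ) (1/2)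

/-- The lattice dispersion relation `e(p) = ∑_j (1 - cos(2π p_j))`. -/
def edisp (p : Fin 3 → ℝ) : ℝ := ∑ j, (1 - Real.cos (2 * Real.pi * p j))

/-- `Θ_ε(α) = ∫_{𝕋³} dq / (α - e(q) + iε)`. -/
def ThetaEps (ε α : ℝ) : ℂ := ∫ q in T3, ((α : ℂ) - (edisp q : ℂ) + (ε : ℂ) * Complex.I)⁻¹

/-- `Θ` is the limit of `Θ_ε` as `ε → 0⁺`. -/
def IsThetaLimit (Θ : ℝ → ℂ) : Prop :=
  ∀ α : ℝ, Tendsto (fun ε => ThetaEps ε α) (𝓝[>] (0 : ℝ)) (𝓝 (Θ α))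

/-- The renormalized dispersion `ω(p) = e(p) + λ² Θ(e(p))`. -/
def omegaR (Θ : ℝ → ℂ) (lam : ℝ) (p : Fin 3 → ℝ) : ℂ :=
  (edisp p : ℂ) + (lam : ℂ) ^ 2 * Θ (edisp p)

/-- A function on `𝕋³`, i.e. a `ℤ³`-periodic function on `ℝ³`. -/
def ZPeriodic (g : (Fin 3 → ℝ) → ℂ) : Prop :=
  ∀ (p : Fin 3 → ℝ) (n : Fin 3 → ℤ), g (p + fun j => (n j : ℝ)) = g p

/-- The `C¹` norm `‖g‖_∞ + ‖∇g‖_∞`. -/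
def C1Norm (g : (Fin 3 → ℝ) → ℂ) : ℝ :=
  (⨆ p : Fin 3 → ℝ, ‖g p‖) + ⨆ p : Fin 3 → ℝ, ‖fderiv ℝ g p‖

/-- `|||α||| = min {|α|, |α-2|, |α-3|, |α-4|, |α-6|}`. -/
def anorm (a : ℝ) : ℝ := min (min (min |a| |a - 2|) (min |a - 3| |a - 4|)) |a - 6|

/-- Distance between two points of the circle `ℝ/ℤ`. -/
def cdist (x y : ℝ) : ℝ := |x - y - (round (x - y) : ℝ)|

/-- `|||q||| = η + min {dist(q, γ) : γ a critical point of e}` (torus distance);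
the critical points are exactly the points with all coordinates in `{0, 1/2}` mod `1`,
and minimizing over them coordinatewise gives the formula below. -/
def tnorm (η : ℝ) (q : Fin 3 → ℝ) : ℝ :=
  η + Real.sqrt (∑ j, (min (cdist (q j) 0) (cdist (q j) (1/2))) ^ 2)

/-- `|∇e(q)|`, the Euclidean length of the gradient of the dispersion relation. -/
def gradNorm (q : Fin 3 → ℝ) : ℝ := Real.sqrt (∑ j, (2 * Real.pi * Real.sin (2 * Real.pi * q j)) ^ 2)


lemma per_le (F : ℝ → ℝ) (hc : Continuous F) (ha : AntitoneOn F (Set.Ici 0)) :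
    ∫ x in (-(1/2):ℝ)..(1/2), F |Real.sin (Real.pi * x)| ≤ ∫ x in (-(1/2):ℝ)..(1/2), F (2 * |x|) := by
  apply intervalIntegral.integral_mono_on (by norm_num)
  · exact (by fun_prop : Continuous fun x => F |Real.sin (Real.pi * x)|).intervalIntegrable _ _
  · exact (by fun_prop : Continuous fun x => F (2 * |x|)).intervalIntegrable _ _
  · intro x hx
    apply ha
    · simp
    · simp
    · have h := Real.mul_abs_le_abs_sin (x := Real.pi * x) (by
        rw [abs_mul, abs_of_pos Real.pi_pos]
        have : |x| ≤ 1/2 := abs_le.2 ⟨by linarith [hx.1], hx.2⟩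
        nlinarith [Real.pi_pos])
      rw [abs_mul, abs_of_pos Real.pi_pos] at h
      have : 2 / Real.pi * (Real.pi * |x|) = 2 * |x| := by field_simp
      linarith

lemma per_absin (F : ℝ → ℝ) : Function.Periodic (fun x => F |Real.sin (Real.pi * x)|) 1 := by
  intro x
  simp only [mul_add, mul_one, Real.sin_add_pi, abs_neg]

lemma per_shift (F : ℝ → ℝ) (y : ℝ) :
    ∫ x in (-(1/2):ℝ)..(1/2), F |Real.sin (Real.pi * (x + y))| =
      ∫ x in (-(1/2):ℝ)..(1/2), F |Real.sin (Real.pi * x)| := by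
  rw [intervalIntegral.integral_comp_add_right (fun x => F |Real.sin (Real.pi * x)|)]
  have := (per_absin F).intervalIntegral_add_eq (-(1/2)+y) (-(1/2))
  convert this using 2 <;> ring

lemma per_double (F : ℝ → ℝ) (hc : Continuous F) :
    ∫ x in (-(1/2):ℝ)..(1/2), F |Real.sin (2 * Real.pi * x)| =
      ∫ x in (-(1/2):ℝ)..(1/2), F |Real.sin (Real.pi * x)| := by
  have h1 : ∀ x, F |Real.sin (2 * Real.pi * x)| = (fun x => F |Real.sin (Real.pi * x)|) (2 * x) := by
    intro x; simp only; congr 3; ring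
  rw [intervalIntegral.integral_congr (fun x _ => h1 x)]
  rw [intervalIntegral.integral_comp_mul_left (fun x => F |Real.sin (Real.pi * x)|) (by norm_num)]
  have hi : ∀ a b, IntervalIntegrable (fun x => F |Real.sin (Real.pi * x)|) volume a b := fun a b =>
    (by fun_prop : Continuous fun x => F |Real.sin (Real.pi * x)|).intervalIntegrable _ _
  rw [← intervalIntegral.integral_add_adjacent_intervals (hi _ 0) (hi 0 _)]
  have e1 := (per_absin F).intervalIntegral_add_eq (2 * -(1/2)) (-(1/2))
  have e2 := (per_absin F).intervalIntegral_add_eq 0 (-(1/2))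
  norm_num at e1 e2 ⊢
  rw [e1, e2]; ring

lemma int_arctan {c m : ℝ} (hc : 0 < c) (hm : 0 < m) (a b : ℝ) :
    ∫ x in a..b, ((c * x) ^ 2 + m ^ 2)⁻¹ ≤ Real.pi / (c * m) := by
  have h1 : ∀ x : ℝ, ((c * x) ^ 2 + m ^ 2)⁻¹ = (m^2)⁻¹ * (fun y => (1 + y ^ 2)⁻¹) ((c/m) * x) := by
    intro x; simp only; field_simp; ring
  rw [intervalIntegral.integral_congr (fun x _ => h1 x)]
  rw [intervalIntegral.integral_const_mul,
    intervalIntegral.integral_comp_mul_left (fun y : ℝ => (1 + y ^ 2)⁻¹) (by positivity),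
    integral_inv_one_add_sq, smul_eq_mul]
  have h2 := Real.arctan_lt_pi_div_two (c / m * b)
  have h3 := Real.neg_pi_div_two_lt_arctan (c / m * a)
  calc _ ≤ (m^2)⁻¹ * ((c/m)⁻¹ * Real.pi) := by gcongr; linarith
    _ = _ := by field_simp

lemma int_arsinh {η : ℝ} (hη : 0 < η) (hη1 : η ≤ 1) :
    ∫ x in (-(1/2):ℝ)..(1/2), (Real.sqrt ((2 * |x|)^2 + η))⁻¹ ≤ 2 - Real.log η := by
  have hs : 0 < Real.sqrt η := Real.sqrt_pos.2 hη
  have hd : ∀ x ∈ Set.uIcc (-(1/2):ℝ) (1/2),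
      HasDerivAt (fun x => (1/2) * Real.arsinh ((2 / Real.sqrt η) * x))
        (Real.sqrt ((2 * |x|)^2 + η))⁻¹ x := by
    intro x _
    have := ((((hasDerivAt_id x).const_mul (2 / Real.sqrt η)).arsinh).const_mul (1/2))
    refine this.congr_deriv ?_
    have h4 : (2 * |x|)^2 + η = η * (1 + (2 / Real.sqrt η * x)^2) := by
      rw [mul_pow, sq_abs, mul_pow, div_pow, Real.sq_sqrt hη.le]; field_simp; ring
    rw [h4, Real.sqrt_mul hη.le]
    simp only [id, smul_eq_mul, mul_inv]
    field_simp
  rw [intervalIntegral.integral_eq_sub_of_hasDerivAt hd]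
  · have h5 : 2 / Real.sqrt η * -(1/2) = - (1 / Real.sqrt η) := by ring
    have h6 : 2 / Real.sqrt η * (1/2) = (1 / Real.sqrt η) := by ring
    rw [h5, h6, Real.arsinh_neg, Real.arsinh]
    have hs1 : Real.sqrt η ≤ 1 := Real.sqrt_le_one.2 hη1
    have h7 : 1 / Real.sqrt η + Real.sqrt (1 + (1 / Real.sqrt η)^2) ≤ 3 / Real.sqrt η := by
      have : Real.sqrt (1 + (1 / Real.sqrt η)^2) ≤ 2 / Real.sqrt η := by
        rw [Real.sqrt_le_left (by positivity)]
        have : 1 ≤ 1 / Real.sqrt η := by rw [le_div_iff₀ hs]; linarith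
        have h8 : 2 / Real.sqrt η = 2 * (1 / Real.sqrt η) := by ring
        rw [h8]; nlinarith
      calc _ ≤ 1 / Real.sqrt η + 2 / Real.sqrt η := by linarith
        _ = _ := by ring
    have h8 := Real.log_le_log (by positivity) h7
    rw [Real.log_div (by norm_num) hs.ne', Real.log_sqrt hη.le] at h8
    have h9 : Real.log 3 ≤ 2 := by
      have := Real.log_le_sub_one_of_pos (show (0:ℝ) < 3 by norm_num); linarith
    have h10 : Real.log η ≤ 0 := Real.log_nonpos hη.le hη1
    linarith
  · apply Continuous.intervalIntegrable
    refine Continuous.inv₀ (by fun_prop) ?_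
    intro x; positivity

lemma int_sin2 {c m : ℝ} (hc : 0 < c) (hm : 0 < m) :
    ∫ x in (-(1/2):ℝ)..(1/2), ((c * |Real.sin (Real.pi * x)|)^2 + m^2)⁻¹ ≤ Real.pi / (2 * c * m) := by
  have hcont : Continuous fun t : ℝ => ((c * t)^2 + m^2)⁻¹ :=
    Continuous.inv₀ (by fun_prop) (fun x => by positivity)
  have := per_le (fun t => ((c * t)^2 + m^2)⁻¹) hcont (by
    intro a ha b hb hab
    simp only [Set.mem_Ici] at ha hb
    simp only
    gcongr)
  refine this.trans ?_
  have h := int_arctan (c := 2 * c) (m := m) (by positivity) hm (-(1/2)) (1/2)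
  refine le_trans (le_of_eq ?_) h
  apply intervalIntegral.integral_congr
  intro x _
  simp only
  rw [mul_pow, mul_pow, sq_abs, mul_pow, mul_pow]; ring

lemma cos_prod (x y : ℝ) : |Real.cos (2 * Real.pi * y) - Real.cos (2 * Real.pi * x)| =
    2 * |Real.sin (Real.pi * (x + y))| * |Real.sin (Real.pi * (x + -y))| := by
  rw [Real.cos_sub_cos, abs_mul, abs_mul]
  have e1 : (2 * Real.pi * y + 2 * Real.pi * x) / 2 = Real.pi * (x + y) := by ring
  have e2 : (2 * Real.pi * y - 2 * Real.pi * x) / 2 = -(Real.pi * (x + -y)) := by ring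
  rw [e1, e2, Real.sin_neg, abs_neg]; norm_num

lemma inv_prod_le {u v η : ℝ} (hu : 0 ≤ u) (hv : 0 ≤ v) (hη : 0 < η) :
    (2 * u * v + η)⁻¹ ≤ (u^2 + η)⁻¹ + (v^2+η)⁻¹ := by
  rcases le_total u v with h | h
  · have : (2 * u * v + η)⁻¹ ≤ (u^2 + η)⁻¹ := by gcongr; nlinarith
    have : 0 ≤ (v^2+η)⁻¹ := by positivity
    linarith
  · have : (2 * u * v + η)⁻¹ ≤ (v^2 + η)⁻¹ := by gcongr; nlinarith
    have : 0 ≤ (u^2+η)⁻¹ := by positivity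
    linarith

lemma int_cos_y {η : ℝ} (hη : 0 < η) (y : ℝ) :
    ∫ x in (-(1/2):ℝ)..(1/2), (|Real.cos (2 * Real.pi * y) - Real.cos (2 * Real.pi * x)| + η)⁻¹
      ≤ Real.pi / Real.sqrt η := by
  have hs : 0 < Real.sqrt η := Real.sqrt_pos.2 hη
  have hsq : Real.sqrt η ^ 2 = η := Real.sq_sqrt hη.le
  have hF : Continuous fun t : ℝ => ((1 * t)^2 + Real.sqrt η ^2)⁻¹ :=
    Continuous.inv₀ (by fun_prop) (fun x => by positivity)
  have key : ∀ w : ℝ, ∫ x in (-(1/2):ℝ)..(1/2), (|Real.sin (Real.pi * (x + w))| ^ 2 + η)⁻¹ ≤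
      Real.pi / (2 * Real.sqrt η) := by
    intro w
    have h1 := per_shift (fun t : ℝ => ((1 * t)^2 + Real.sqrt η ^2)⁻¹) w
    have h2 := int_sin2 (c := 1) one_pos hs
    rw [← h1] at h2
    simpa [hsq] using h2
  have hi : ∀ w : ℝ, IntervalIntegrable (fun x => (|Real.sin (Real.pi * (x + w))| ^ 2 + η)⁻¹) volume (-(1/2)) (1/2) := by
    intro w
    apply Continuous.intervalIntegrable
    exact Continuous.inv₀ (by fun_prop) (fun x => by positivity)
  calc _ ≤ ∫ x in (-(1/2):ℝ)..(1/2), ((|Real.sin (Real.pi * (x + y))| ^ 2 + η)⁻¹ + (|Real.sin (Real.pi * (x + -y))| ^ 2 + η)⁻¹) := by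
        apply intervalIntegral.integral_mono_on (by norm_num)
        · apply Continuous.intervalIntegrable
          exact Continuous.inv₀ (by fun_prop) (fun x => by positivity)
        · exact (hi _).add (hi _)
        · intro x _
          rw [cos_prod]
          exact inv_prod_le (abs_nonneg _) (abs_nonneg _) hη
    _ ≤ Real.pi / (2 * Real.sqrt η) + Real.pi / (2 * Real.sqrt η) := by
        rw [intervalIntegral.integral_add (hi _) (hi _)]
        exact add_le_add (key _) (key _)
    _ = _ := by field_simp; ring

lemma int_cos {η : ℝ} (hη : 0 < η) (a : ℝ) :
    ∫ x in (-(1/2):ℝ)..(1/2), (|a + Real.cos (2 * Real.pi * x)| + η)⁻¹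
      ≤ Real.pi / Real.sqrt η := by
  obtain ⟨y, hy⟩ : ∃ y, ∀ x, |Real.cos (2 * Real.pi * y) - Real.cos (2 * Real.pi * x)| ≤ |a + Real.cos (2 * Real.pi * x)| := by
    rcases le_total (-a) (-1) with h | h
    · refine ⟨1/2, fun x => ?_⟩
      rw [show 2 * Real.pi * (1/2) = Real.pi by ring, Real.cos_pi]
      have := Real.neg_one_le_cos (2 * Real.pi * x)
      rw [abs_of_nonpos (by linarith), abs_of_nonneg (by linarith)]; linarith
    rcases le_total (-a) 1 with h' | h'
    · refine ⟨Real.arccos (-a) / (2 * Real.pi), fun x => ?_⟩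
      rw [mul_div_cancel₀ _ (by positivity), Real.cos_arccos h h', ← abs_neg]
      apply le_of_eq; congr 1; ring
    · refine ⟨0, fun x => ?_⟩
      have := Real.cos_le_one (2 * Real.pi * x)
      rw [mul_zero, Real.cos_zero, abs_of_nonneg (by linarith), abs_of_nonpos (by linarith)]; linarith
  refine le_trans ?_ (int_cos_y hη y)
  apply intervalIntegral.integral_mono_on (by norm_num)
  · apply Continuous.intervalIntegrable
    exact Continuous.inv₀ (by fun_prop) (fun x => by positivity)
  · apply Continuous.intervalIntegrable
    exact Continuous.inv₀ (by fun_prop) (fun x => by positivity)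
  · intro x _
    have := hy x
    gcongr

lemma int_inner {m : ℝ} (hm : 0 < m) :
    ∫ x in (-(1/2):ℝ)..(1/2), (Real.sin (2 * Real.pi * x) ^ 2 + m)⁻¹ ≤ 2 * (Real.sqrt m)⁻¹ := by
  have hs : 0 < Real.sqrt m := Real.sqrt_pos.2 hm
  have hsq : Real.sqrt m ^ 2 = m := Real.sq_sqrt hm.le
  have h1 := per_double (fun t => ((1 * t)^2 + Real.sqrt m ^2)⁻¹)
    (Continuous.inv₀ (by fun_prop) (fun x => by positivity))
  have h2 := int_sin2 (c := 1) one_pos hs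
  rw [← h1] at h2
  simp only [one_mul, sq_abs, hsq] at h2
  refine h2.trans ?_
  have := Real.pi_le_four
  rw [mul_one, ← div_eq_mul_inv, div_le_div_iff₀ (by positivity) hs]
  nlinarith

lemma int_outer {η : ℝ} (hη : 0 < η) (hη1 : η ≤ 1) :
    ∫ x in (-(1/2):ℝ)..(1/2), (Real.sqrt (Real.sin (2 * Real.pi * x) ^ 2 + η))⁻¹ ≤ 2 - Real.log η := by
  have hc : Continuous (fun t : ℝ => (Real.sqrt (t^2 + η))⁻¹) :=
    Continuous.inv₀ (by fun_prop) (fun x => by positivity)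
  have h1 := per_double (fun t => (Real.sqrt (t^2 + η))⁻¹) hc
  have h2 := per_le (fun t => (Real.sqrt (t^2 + η))⁻¹) hc (by
    intro a ha b hb hab
    simp only [Set.mem_Ici] at ha hb
    simp only
    gcongr)
  rw [← h1] at h2
  simp only [sq_abs] at h2
  refine h2.trans ?_
  simpa using int_arsinh hη hη1

def II : Set ℝ := Set.Icc (-(1/2) : ℝ) (1/2)

lemma II_int (f : ℝ → ℝ) : ∫ x in II, f x = ∫ x in (-(1/2):ℝ)..(1/2), f x := by
  rw [intervalIntegral.integral_of_le (by norm_num), II, integral_Icc_eq_integral_Ioc]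

lemma II_cpt : IsCompact II := isCompact_Icc

lemma T3_restrict : (volume : Measure (Fin 3 → ℝ)).restrict T3 =
    Measure.pi (fun _ => (volume : Measure ℝ).restrict II) := by
  rw [volume_pi]; exact Measure.restrict_pi_pi _ _

lemma T3_cpt : IsCompact T3 := isCompact_univ_pi fun _ => isCompact_Icc

lemma T3_fub (f : (Fin 3 → ℝ) → ℝ) (hf : Continuous f) :
    ∫ p in T3, f p = ∫ x in II, ∫ y in II, ∫ z in II, f ![x, y, z] := by
  have hIntg : IntegrableOn f T3 := hf.continuousOn.integrableOn_compact T3_cpt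
  rw [IntegrableOn, T3_restrict] at hIntg
  rw [T3_restrict]
  have mp := (measurePreserving_piFinSuccAbove
    (fun _ : Fin 3 => (volume : Measure ℝ).restrict II) 0).symm
  rw [← mp.integral_comp']
  rw [← mp.integrable_comp_emb (MeasurableEquiv.measurableEmbedding _)] at hIntg
  refine (integral_prod _ hIntg).trans ?_
  refine integral_congr_ae (Filter.Eventually.of_forall fun x => ?_)
  simp only
  have mp2 := (measurePreserving_finTwoArrow ((volume : Measure ℝ).restrict II)).symm
  rw [← mp2.integral_comp']
  rw [integral_prod]
  · refine integral_congr_ae (Filter.Eventually.of_forall fun y => ?_)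
    refine integral_congr_ae (Filter.Eventually.of_forall fun z => ?_)
    refine congrArg f ?_
    ext i
    fin_cases i <;> rfl
  · rw [Measure.prod_restrict]
    have : Continuous fun q : ℝ × ℝ => f ![x, q.1, q.2] := by
      refine hf.comp (continuous_pi fun i => ?_)
      fin_cases i
      · exact continuous_const
      · exact continuous_fst
      · exact continuous_snd
    refine IntegrableOn.congr_fun (this.continuousOn.integrableOn_compact (II_cpt.prod II_cpt)) ?_
      (II_cpt.prod II_cpt).measurableSet
    intro q _
    refine congrArg f ?_
    ext i
    fin_cases i <;> rfl

def SS (η : ℝ) (p : Fin 3 → ℝ) : ℝ :=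
  Real.sin (2 * Real.pi * p 0) ^ 2 + Real.sin (2 * Real.pi * p 1) ^ 2 + η

lemma SS_pos {η : ℝ} (hη : 0 < η) (p : Fin 3 → ℝ) : 0 < SS η p := by unfold SS; positivity

lemma SS_cont (η : ℝ) : Continuous (SS η) := by unfold SS; fun_prop

lemma edisp_cont : Continuous edisp := by unfold edisp; fun_prop

lemma K_bound {η : ℝ} (hη : 0 < η) (hη1 : η ≤ 1) (a : ℝ) :
    ∫ p in T3, (SS η p)⁻¹ * (|a - edisp p| + η)⁻¹ ≤ 16 * ((1 - Real.log η) / Real.sqrt η) := by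
  have hs : 0 < Real.sqrt η := Real.sqrt_pos.2 hη
  have hlog : Real.log η ≤ 0 := Real.log_nonpos hη.le hη1
  have hc : Continuous fun p => (SS η p)⁻¹ * (|a - edisp p| + η)⁻¹ := by
    refine Continuous.mul (Continuous.inv₀ (SS_cont η) fun p => (SS_pos hη p).ne') ?_
    have := edisp_cont
    exact Continuous.inv₀ (by fun_prop) (fun x => by positivity)
  rw [T3_fub _ hc]
  have hc1 : ∀ m : ℝ, 0 < m → Continuous fun y => (Real.sin (2 * Real.pi * y) ^ 2 + m)⁻¹ :=
    fun m hm => Continuous.inv₀ (by fun_prop) (fun x => by positivity)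
  have inner : ∀ x y, ∫ z in II, (SS η ![x, y, z])⁻¹ * (|a - edisp ![x, y, z]| + η)⁻¹ ≤
      (Real.sin (2 * Real.pi * y) ^ 2 + (Real.sin (2 * Real.pi * x) ^ 2 + η))⁻¹ * (Real.pi / Real.sqrt η) := by
    intro x y
    have e1 : ∀ z, (SS η ![x, y, z])⁻¹ * (|a - edisp ![x, y, z]| + η)⁻¹ =
        (Real.sin (2 * Real.pi * y) ^ 2 + (Real.sin (2 * Real.pi * x) ^ 2 + η))⁻¹ *
        (|(a - 3 + Real.cos (2 * Real.pi * x) + Real.cos (2 * Real.pi * y)) + Real.cos (2 * Real.pi * z)| + η)⁻¹ := by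
      intro z
      simp only [SS, edisp, Fin.sum_univ_three, Matrix.cons_val_zero, Matrix.cons_val_one, Matrix.cons_val]
      congr 2
      · ring
      · congr 2; ring
    simp_rw [e1]
    rw [integral_const_mul, II_int]
    gcongr
    exact int_cos hη _
  have mid : ∀ x, ∫ y in II, ∫ z in II, (SS η ![x, y, z])⁻¹ * (|a - edisp ![x, y, z]| + η)⁻¹ ≤
      2 * (Real.sqrt (Real.sin (2 * Real.pi * x) ^ 2 + η))⁻¹ * (Real.pi / Real.sqrt η) := by
    intro x
    have hm : 0 < Real.sin (2 * Real.pi * x) ^ 2 + η := by positivity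
    calc _ ≤ ∫ y in II, (Real.sin (2 * Real.pi * y) ^ 2 + (Real.sin (2 * Real.pi * x) ^ 2 + η))⁻¹ * (Real.pi / Real.sqrt η) := by
          apply integral_mono_of_nonneg
          · refine Filter.Eventually.of_forall fun y => integral_nonneg fun z => ?_
            have := SS_pos hη ![x, y, z]
            simp only [Pi.zero_apply]; positivity
          · have := hc1 _ hm
            exact (by fun_prop : Continuous fun y => (Real.sin (2 * Real.pi * y) ^ 2 + (Real.sin (2 * Real.pi * x) ^ 2 + η))⁻¹ * (Real.pi / Real.sqrt η)).continuousOn.integrableOn_compact II_cpt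
          · exact Filter.Eventually.of_forall fun y => inner x y
      _ ≤ _ := by
          rw [integral_mul_const, II_int]
          gcongr
          exact int_inner hm
  calc _ ≤ ∫ x in II, 2 * (Real.sqrt (Real.sin (2 * Real.pi * x) ^ 2 + η))⁻¹ * (Real.pi / Real.sqrt η) := by
        apply integral_mono_of_nonneg
        · refine Filter.Eventually.of_forall fun x => integral_nonneg fun y => integral_nonneg fun z => ?_
          have := SS_pos hη ![x, y, z]
          simp only [Pi.zero_apply]; positivity
        · have : Continuous fun x => (Real.sqrt (Real.sin (2 * Real.pi * x) ^ 2 + η))⁻¹ :=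
            Continuous.inv₀ (by fun_prop) (fun x => by positivity)
          exact (by fun_prop : Continuous fun x => 2 * (Real.sqrt (Real.sin (2 * Real.pi * x) ^ 2 + η))⁻¹ * (Real.pi / Real.sqrt η)).continuousOn.integrableOn_compact II_cpt
        · exact Filter.Eventually.of_forall fun x => mid x
    _ ≤ 2 * (2 - Real.log η) * (Real.pi / Real.sqrt η) := by
        rw [integral_mul_const, integral_const_mul, II_int]
        gcongr
        exact int_outer hη hη1
    _ ≤ 2 * (2 * (1 - Real.log η)) * (4 / Real.sqrt η) := by
        gcongr
        · linarith
        · linarith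
        · exact Real.pi_le_four
    _ = _ := by ring

lemma T3_eq : T3 = Set.Icc (fun _ => -(1/2)) (fun _ => 1/2) := by
  unfold T3; exact Set.pi_univ_Icc _ _

lemma div_zero3 (H : Fin 3 → (Fin 3 → ℝ) → ℂ) (hC : ∀ i, ContDiff ℝ 1 (H i))
    (hP : ∀ i, ZPeriodic (H i)) :
    ∫ p in T3, ∑ i, fderiv ℝ (H i) p (Pi.single i 1) = 0 := by
  rw [T3_eq]
  rw [integral_divergence_of_hasFDerivAt_off_countable' (fun _ => -(1/2)) (fun _ => 1/2)
    (fun i => by norm_num) H (fun i => fderiv ℝ (H i)) ∅ Set.countable_empty]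
  · apply Finset.sum_eq_zero
    intro i _
    rw [sub_eq_zero]
    congr 1
    ext x
    have := hP i (Fin.insertNth i (-(1/2)) x) (Pi.single i 1)
    rw [← this]
    congr 1
    ext j
    refine Fin.succAboveCases i ?_ (fun j => ?_) j
    · simp; norm_num
    · simp
  · intro i; exact (hC i).continuous.continuousOn
  · intro x _ i
    exact ((hC i).differentiable (by norm_num) x).hasFDerivAt
  · apply ContinuousOn.integrableOn_compact isCompact_Icc
    apply Continuous.continuousOn
    apply continuous_finsetSum
    intro i _
    exact ((hC i).continuous_fderiv (by norm_num)).clm_apply continuous_const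

lemma div_zero1 (H : (Fin 3 → ℝ) → ℂ) (hC : ContDiff ℝ 1 H) (hP : ZPeriodic H) (j : Fin 3) :
    ∫ p in T3, fderiv ℝ H p (Pi.single j 1) = 0 := by
  have := div_zero3 (fun i => if i = j then H else fun _ => 0) (by
    intro i; split_ifs
    · exact hC
    · exact contDiff_const) (by
    intro i; split_ifs
    · exact hP
    · intro p n; rfl)
  rw [← this]
  congr 1
  ext p
  rw [Finset.sum_eq_single j]
  · simp
  · intro b _ hb
    simp [hb]
  · simp

def RR (z : ℂ) (p : Fin 3 → ℝ) : ℂ := (z - (edisp p : ℂ))⁻¹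

lemma RR_ne {z : ℂ} (hz : 0 < z.im) (e : ℝ) : z - (e : ℂ) ≠ 0 := by
  intro h
  have := congrArg Complex.im h
  simp at this
  linarith

lemma edisp_contDiff : ContDiff ℝ 1 edisp := by
  unfold edisp
  fun_prop

lemma RR_contDiff {z : ℂ} (hz : 0 < z.im) : ContDiff ℝ 1 (RR z) := by
  unfold RR
  apply ContDiff.inv
  · apply contDiff_const.sub
    exact Complex.ofRealCLM.contDiff.comp edisp_contDiff
  · intro p; exact RR_ne hz _

def VV (η : ℝ) (j : Fin 3) (p : Fin 3 → ℝ) : ℝ := Real.sin (2 * Real.pi * p j) / SS η p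

lemma SS_contDiff (η : ℝ) : ContDiff ℝ 1 (SS η) := by unfold SS; fun_prop

lemma VV_contDiff {η : ℝ} (hη : 0 < η) (j : Fin 3) : ContDiff ℝ 1 (VV η j) := by
  unfold VV
  apply ContDiff.div
  · fun_prop
  · exact SS_contDiff η
  · intro p; exact (SS_pos hη p).ne'

lemma sin_per (x : ℝ) (n : ℤ) : Real.sin (2 * Real.pi * (x + n)) = Real.sin (2 * Real.pi * x) := by
  rw [show 2 * Real.pi * (x + n) = 2 * Real.pi * x + n * (2 * Real.pi) by ring]
  exact Real.sin_add_int_mul_two_pi _ _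

lemma cos_per (x : ℝ) (n : ℤ) : Real.cos (2 * Real.pi * (x + n)) = Real.cos (2 * Real.pi * x) := by
  rw [show 2 * Real.pi * (x + n) = 2 * Real.pi * x + n * (2 * Real.pi) by ring]
  exact Real.cos_add_int_mul_two_pi _ _

lemma edisp_line (p : Fin 3 → ℝ) (j : Fin 3) (t : ℝ) :
    edisp (p + t • Pi.single j 1) =
      edisp p + Real.cos (2 * Real.pi * p j) - Real.cos (2 * Real.pi * (p j + t)) := by
  unfold edisp
  rw [Fin.sum_univ_three, Fin.sum_univ_three]
  fin_cases j <;> simp <;> ring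

lemma SS_line (η : ℝ) (p : Fin 3 → ℝ) (j k : Fin 3) (hjk : (j = 0 ∧ k = 1) ∨ (j = 1 ∧ k = 0)) (t : ℝ) :
    SS η (p + t • Pi.single j 1) = Real.sin (2 * Real.pi * (p j + t)) ^ 2
      + (Real.sin (2 * Real.pi * p k) ^ 2 + η) := by
  unfold SS
  rcases hjk with ⟨rfl, rfl⟩ | ⟨rfl, rfl⟩ <;> simp <;> ring

lemma hasDerivAt_sin_line (x : ℝ) : HasDerivAt (fun t => Real.sin (2 * Real.pi * (x + t)))
    (2 * Real.pi * Real.cos (2 * Real.pi * x)) 0 := by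
  have := ((((hasDerivAt_id (0:ℝ)).const_add x).const_mul (2 * Real.pi))).sin
  refine this.congr_deriv ?_
  simp; ring

lemma hasDerivAt_cos_line (x : ℝ) : HasDerivAt (fun t => Real.cos (2 * Real.pi * (x + t)))
    (-(2 * Real.pi * Real.sin (2 * Real.pi * x))) 0 := by
  have := ((((hasDerivAt_id (0:ℝ)).const_add x).const_mul (2 * Real.pi))).cos
  refine this.congr_deriv ?_
  simp; ring

def DV (η : ℝ) (j : Fin 3) (p : Fin 3 → ℝ) : ℝ :=
  (2 * Real.pi * Real.cos (2 * Real.pi * p j) * SS η p - Real.sin (2 * Real.pi * p j) *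
    (2 * Real.sin (2 * Real.pi * p j) * (2 * Real.pi * Real.cos (2 * Real.pi * p j)))) / (SS η p) ^ 2

lemma VV_line {η : ℝ} (hη : 0 < η) (p : Fin 3 → ℝ) (j k : Fin 3)
    (hjk : (j = 0 ∧ k = 1) ∨ (j = 1 ∧ k = 0)) :
    HasDerivAt (fun t : ℝ => VV η j (p + t • Pi.single j 1)) (DV η j p) 0 := by
  have h1 := hasDerivAt_sin_line (p j)
  have h2 : HasDerivAt (fun t : ℝ => SS η (p + t • Pi.single j 1)) 
      (2 * Real.sin (2 * Real.pi * p j) * (2 * Real.pi * Real.cos (2 * Real.pi * p j))) 0 := by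
    simp_rw [SS_line η p j k hjk]
    refine ((h1.pow 2).add_const _).congr_deriv ?_
    simp
  have h3 := h1.div h2 (SS_pos hη _).ne'
  have h4 : (fun t : ℝ => VV η j (p + t • Pi.single j 1)) =
      (fun t => Real.sin (2 * Real.pi * (p j + t))) / (fun t : ℝ => SS η (p + t • Pi.single j 1)) := by
    ext t; simp [VV]
  rw [h4]
  refine h3.congr_deriv ?_
  simp [DV]

lemma RR_line {z : ℂ} (hz : 0 < z.im) (p : Fin 3 → ℝ) (j : Fin 3) :
    HasDerivAt (fun t : ℝ => RR z (p + t • Pi.single j 1))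
      ((2 * Real.pi * Real.sin (2 * Real.pi * p j) : ℝ) * RR z p ^ 2) 0 := by
  have h1 : HasDerivAt (fun t : ℝ => edisp (p + t • Pi.single j 1))
      (2 * Real.pi * Real.sin (2 * Real.pi * p j)) 0 := by
    simp_rw [edisp_line]
    refine ((hasDerivAt_cos_line (p j)).const_sub _).congr_deriv ?_
    ring
  have h2 := (h1.ofReal_comp.const_sub z).inv (by exact RR_ne hz _)
  refine HasDerivAt.congr_deriv (h2 : HasDerivAt (fun t : ℝ => RR z (p + t • Pi.single j 1)) _ 0) ?_
  simp [RR]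
  ring

lemma main_line {z : ℂ} (hz : 0 < z.im) (g : (Fin 3 → ℝ) → ℂ) (hg : ContDiff ℝ 1 g)
    (p : Fin 3 → ℝ) (j k : Fin 3) (hjk : (j = 0 ∧ k = 1) ∨ (j = 1 ∧ k = 0)) :
    fderiv ℝ (fun p => g p * (VV z.im j p : ℂ) * RR z p) p (Pi.single j 1) =
      (fderiv ℝ g p (Pi.single j 1) * (VV z.im j p : ℂ) + g p * (DV z.im j p : ℂ)) * RR z p
      + g p * (VV z.im j p : ℂ) * ((2 * Real.pi * Real.sin (2 * Real.pi * p j) : ℝ) * RR z p ^ 2) := by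
  have hH : ContDiff ℝ 1 (fun p => g p * (VV z.im j p : ℂ) * RR z p) :=
    (hg.mul (Complex.ofRealCLM.contDiff.comp (VV_contDiff hz j))).mul (RR_contDiff hz)
  have e1 : HasDerivAt (fun t : ℝ => (fun p => g p * (VV z.im j p : ℂ) * RR z p) (p + t • Pi.single j 1))
      (fderiv ℝ (fun p => g p * (VV z.im j p : ℂ) * RR z p) p (Pi.single j 1)) 0 :=
    (hH.differentiable (by norm_num) p).hasFDerivAt.hasLineDerivAt _
  have e2 : HasDerivAt (fun t : ℝ => g (p + t • Pi.single j 1)) (fderiv ℝ g p (Pi.single j 1)) 0 :=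
    (hg.differentiable (by norm_num) p).hasFDerivAt.hasLineDerivAt _
  have e3 := (e2.mul (VV_line hz p j k hjk).ofReal_comp).mul (RR_line hz p j)
  have := e1.unique e3
  rw [this]
  simp

lemma prod_per {z : ℂ} (g : (Fin 3 → ℝ) → ℂ) (hg : ZPeriodic g) (j : Fin 3) (η : ℝ) :
    ZPeriodic (fun p => g p * (VV η j p : ℂ) * RR z p) := by
  intro p n
  simp only [hg p n, VV, SS, RR, edisp, Pi.add_apply, sin_per, cos_per]

lemma RR_norm {z : ℂ} (hz : 0 < z.im) (p : Fin 3 → ℝ) :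
    ‖RR z p‖ ≤ 2 * (|z.re - edisp p| + z.im)⁻¹ := by
  unfold RR
  rw [norm_inv]
  have h1 := Complex.abs_re_le_norm (z - (edisp p : ℂ))
  have h2 := Complex.abs_im_le_norm (z - (edisp p : ℂ))
  simp only [Complex.sub_re, Complex.ofReal_re, Complex.sub_im, Complex.ofReal_im, sub_zero] at h1 h2
  rw [abs_of_pos hz] at h2
  have h3 : 0 < |z.re - edisp p| + z.im := by positivity
  have h4 : (|z.re - edisp p| + z.im) / 2 ≤ ‖z - (edisp p : ℂ)‖ := by linarith
  calc _ ≤ ((|z.re - edisp p| + z.im) / 2)⁻¹ := by gcongr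
    _ = _ := by rw [inv_div]; rfl

lemma RR_norm_im {z : ℂ} (hz : 0 < z.im) (p : Fin 3 → ℝ) : ‖RR z p‖ ≤ (z.im)⁻¹ := by
  unfold RR
  rw [norm_inv]
  have h2 := Complex.abs_im_le_norm (z - (edisp p : ℂ))
  simp only [Complex.sub_im, Complex.ofReal_im, sub_zero] at h2
  rw [abs_of_pos hz] at h2
  gcongr

lemma VV_abs {η : ℝ} (hη : 0 < η) (j : Fin 3) (p : Fin 3 → ℝ) : |VV η j p| ≤ (SS η p)⁻¹ := by
  unfold VV
  rw [abs_div, abs_of_pos (SS_pos hη p), ← one_div]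
  have := SS_pos hη p
  gcongr
  exact Real.abs_sin_le_one _

lemma DV_abs {η : ℝ} (hη : 0 < η) (j k : Fin 3) (hjk : (j = 0 ∧ k = 1) ∨ (j = 1 ∧ k = 0))
    (p : Fin 3 → ℝ) : |DV η j p| ≤ 24 * (SS η p)⁻¹ := by
  have hS := SS_pos hη p
  have hs : Real.sin (2 * Real.pi * p j) ^ 2 ≤ SS η p := by
    unfold SS
    rcases hjk with ⟨rfl, rfl⟩ | ⟨rfl, rfl⟩ <;> nlinarith [sq_nonneg (Real.sin (2 * Real.pi * p 0)), sq_nonneg (Real.sin (2 * Real.pi * p 1))]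
  unfold DV
  rw [abs_div, abs_of_pos (by positivity : 0 < SS η p ^ 2), div_le_iff₀ (by positivity)]
  have hc : |Real.cos (2 * Real.pi * p j)| ≤ 1 := Real.abs_cos_le_one _
  have e : 24 * (SS η p)⁻¹ * SS η p ^ 2 = 24 * SS η p := by field_simp
  rw [e, show (2 * Real.pi * Real.cos (2 * Real.pi * p j) * SS η p - Real.sin (2 * Real.pi * p j) *
    (2 * Real.sin (2 * Real.pi * p j) * (2 * Real.pi * Real.cos (2 * Real.pi * p j)))) =
     (2 * Real.pi) * (Real.cos (2 * Real.pi * p j) * (SS η p - 2 * Real.sin (2 * Real.pi * p j) ^ 2)) by ring,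
     abs_mul (2 * Real.pi), abs_mul (Real.cos _), abs_of_pos (by positivity : 0 < 2 * Real.pi)]
  have h2 : |SS η p - 2 * Real.sin (2 * Real.pi * p j) ^ 2| ≤ SS η p := by
    rw [abs_le]; constructor <;> nlinarith [sq_nonneg (Real.sin (2 * Real.pi * p j))]
  have h3 : |Real.cos (2 * Real.pi * p j)| * |SS η p - 2 * Real.sin (2 * Real.pi * p j) ^ 2| ≤ 1 * SS η p := by
    gcongr
  have := Real.pi_le_four
  calc _ ≤ (2 * 4) * (1 * SS η p) := by gcongr
    _ ≤ _ := by linarith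

def gd (t : ℝ) : ℝ := (1 - Real.log t) / Real.sqrt t

lemma deriv_bound {z : ℂ} (hz : 0 < z.im) (hz1 : z.im ≤ 1) (g : (Fin 3 → ℝ) → ℂ) (hg : ContDiff ℝ 1 g)
    (hP : ZPeriodic g) (N : ℝ) (hN : ∀ p, ‖g p‖ ≤ N) (hN' : ∀ p, ‖fderiv ℝ g p‖ ≤ N) :
    ‖∫ p in T3, RR z p ^ 2 * g p‖ ≤ 400 * N * gd z.im := by
  set η := z.im with hη
  have hN0 : 0 ≤ N := (norm_nonneg _).trans (hN 0)
  set D : Fin 3 → (Fin 3 → ℝ) → ℂ := fun j p => fderiv ℝ (fun p => g p * (VV η j p : ℂ) * RR z p) p (Pi.single j 1) with hD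
  have hcR := (RR_contDiff hz).continuous
  have hcD : ∀ j, Continuous (D j) := fun j => by
    have hH : ContDiff ℝ 1 (fun p => g p * (VV η j p : ℂ) * RR z p) :=
      (hg.mul (Complex.ofRealCLM.contDiff.comp (VV_contDiff hz j))).mul (RR_contDiff hz)
    exact (hH.continuous_fderiv (by norm_num)).clm_apply continuous_const
  have hD0 : ∀ j, ∫ p in T3, D j p = 0 := fun j =>
    div_zero1 _ ((hg.mul (Complex.ofRealCLM.contDiff.comp (VV_contDiff hz j))).mul (RR_contDiff hz))
      (prod_per g hP j η) j
  have hcg := hg.continuous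
  have hIntg : ∀ f : (Fin 3 → ℝ) → ℂ, Continuous f → IntegrableOn f T3 := fun f hf =>
    hf.continuousOn.integrableOn_compact T3_cpt
  have e1 : (2 * Real.pi : ℂ) * ∫ p in T3, RR z p ^ 2 * g p =
      ∫ p in T3, ((2 * Real.pi : ℂ) * (RR z p ^ 2 * g p) - D 0 p - D 1 p) := by
    have hA : Continuous fun p => (2 * Real.pi : ℂ) * (RR z p ^ 2 * g p) := by fun_prop
    have hB : Continuous fun p => (2 * Real.pi : ℂ) * (RR z p ^ 2 * g p) - D 0 p := hA.sub (hcD 0)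
    rw [integral_sub (hIntg _ hB) (hIntg _ (hcD 1)),
      integral_sub (hIntg _ hA) (hIntg _ (hcD 0)), hD0, hD0, integral_const_mul]
    simp
  have hpt : ∀ p, ‖(2 * Real.pi : ℂ) * (RR z p ^ 2 * g p) - D 0 p - D 1 p‖ ≤
      (120 * N) * ((SS η p)⁻¹ * (|z.re - edisp p| + η)⁻¹) := by
    intro p
    have hS := SS_pos hz p
    have hS' : SS η p = Real.sin (2 * Real.pi * p 0) ^ 2 + Real.sin (2 * Real.pi * p 1) ^ 2 + η := rfl
    have hSC : ((SS η p : ℝ) : ℂ) ≠ 0 := by exact_mod_cast hS.ne'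
    have d0 := main_line hz g hg p 0 1 (Or.inl ⟨rfl, rfl⟩)
    have d1 := main_line hz g hg p 1 0 (Or.inr ⟨rfl, rfl⟩)
    rw [← hη] at d0 d1
    have e2 : (VV η 0 p : ℂ) * (2 * Real.pi * Real.sin (2 * Real.pi * p 0) : ℝ) +
        (VV η 1 p : ℂ) * (2 * Real.pi * Real.sin (2 * Real.pi * p 1) : ℝ) =
        ((2 * Real.pi * (1 - η * (SS η p)⁻¹) : ℝ) : ℂ) := by
      norm_cast
      unfold VV
      have : η = SS η p - Real.sin (2 * Real.pi * p 0) ^ 2 - Real.sin (2 * Real.pi * p 1) ^ 2 := by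
        rw [hS']; ring
      field_simp
      rw [hS']; ring
    have e3 : (2 * Real.pi : ℂ) * (RR z p ^ 2 * g p) - D 0 p - D 1 p =
        (((2 * Real.pi * η * (SS η p)⁻¹ : ℝ) : ℂ) * RR z p * g p
        - (fderiv ℝ g p (Pi.single 0 1) * (VV η 0 p : ℂ) + g p * (DV η 0 p : ℂ))
        - (fderiv ℝ g p (Pi.single 1 1) * (VV η 1 p : ℂ) + g p * (DV η 1 p : ℂ))) * RR z p := by
      rw [show D 0 p = _ from d0, show D 1 p = _ from d1]
      have : (2 * Real.pi : ℂ) = ((2 * Real.pi * (1 - η * (SS η p)⁻¹) : ℝ) : ℂ) + ((2 * Real.pi * η * (SS η p)⁻¹ : ℝ) : ℂ) := by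
        push_cast; ring
      rw [this, ← e2]
      ring
    rw [e3, norm_mul]
    have hder : ∀ j : Fin 3, ‖fderiv ℝ g p (Pi.single j 1)‖ ≤ N := by
      intro j
      refine ((fderiv ℝ g p).le_opNorm _).trans ?_
      have : ‖(Pi.single j 1 : Fin 3 → ℝ)‖ = 1 := by rw [Pi.norm_single]; exact norm_one
      rw [this, mul_one]
      exact hN' p
    have hterm : ∀ j k : Fin 3, (j = 0 ∧ k = 1) ∨ (j = 1 ∧ k = 0) →
        ‖fderiv ℝ g p (Pi.single j 1) * (VV η j p : ℂ) + g p * (DV η j p : ℂ)‖ ≤ 25 * N * (SS η p)⁻¹ := by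
      intro j k hjk
      refine (norm_add_le _ _).trans ?_
      rw [norm_mul, norm_mul, Complex.norm_real, Complex.norm_real, Real.norm_eq_abs, Real.norm_eq_abs]
      calc _ ≤ N * (SS η p)⁻¹ + N * (24 * (SS η p)⁻¹) := by
            gcongr
            · exact hder j
            · exact VV_abs hz j p
            · exact hN p
            · exact DV_abs hz j k hjk p
        _ = _ := by ring
    have hfirst : ‖((2 * Real.pi * η * (SS η p)⁻¹ : ℝ) : ℂ) * RR z p * g p‖ ≤ 8 * N * (SS η p)⁻¹ := by
      rw [norm_mul, norm_mul, Complex.norm_real, Real.norm_eq_abs, abs_of_pos (by have := Real.pi_pos; positivity)]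
      calc _ ≤ (2 * 4 * η * (SS η p)⁻¹) * η⁻¹ * N := by
            gcongr
            · exact Real.pi_le_four
            · exact RR_norm_im hz p
            · exact hN p
        _ = _ := by field_simp; ring
    calc _ ≤ (8 * N * (SS η p)⁻¹ + 25 * N * (SS η p)⁻¹ + 25 * N * (SS η p)⁻¹) * (2 * (|z.re - edisp p| + η)⁻¹) := by
          gcongr
          · refine (norm_sub_le _ _).trans (add_le_add ((norm_sub_le _ _).trans (add_le_add hfirst ?_)) ?_)
            · exact hterm 0 1 (Or.inl ⟨rfl, rfl⟩)
            · exact hterm 1 0 (Or.inr ⟨rfl, rfl⟩)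
          · exact RR_norm hz p
      _ = (116 * N) * ((SS η p)⁻¹ * (|z.re - edisp p| + η)⁻¹) := by ring
      _ ≤ _ := by gcongr; norm_num
  have hcK : Continuous fun p => (SS η p)⁻¹ * (|z.re - edisp p| + η)⁻¹ := by
    refine Continuous.mul (Continuous.inv₀ (SS_cont η) fun p => (SS_pos hz p).ne') ?_
    have := edisp_cont
    exact Continuous.inv₀ (by fun_prop) (fun x => by positivity)
  have hb : ‖(2 * Real.pi : ℂ) * ∫ p in T3, RR z p ^ 2 * g p‖ ≤ (120 * N) * (16 * gd η) := by
    rw [e1]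
    refine (norm_integral_le_of_norm_le (((by fun_prop : Continuous fun p => (120 * N) * ((SS η p)⁻¹ * (|z.re - edisp p| + η)⁻¹))).continuousOn.integrableOn_compact T3_cpt) (Filter.Eventually.of_forall hpt)).trans ?_
    rw [integral_const_mul]
    gcongr
    exact K_bound hz hz1 _
  rw [norm_mul] at hb
  have : ‖(2 * Real.pi : ℂ)‖ = 2 * Real.pi := by
    rw [norm_mul, Complex.norm_real, Real.norm_eq_abs, abs_of_pos Real.pi_pos]; simp
  rw [this] at hb
  have := Real.pi_gt_three
  nlinarith [norm_nonneg (∫ p in T3, RR z p ^ 2 * g p)]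

def Good (g : (Fin 3 → ℝ) → ℂ) (N : ℝ) : Prop :=
  ContDiff ℝ 1 g ∧ ZPeriodic g ∧ (∀ p, ‖g p‖ ≤ N) ∧ (∀ p, ‖fderiv ℝ g p‖ ≤ N)

def FF (g : (Fin 3 → ℝ) → ℂ) (z : ℂ) : ℂ := ∫ p in T3, RR z p * g p

lemma T3_fin : IsFiniteMeasure ((volume : Measure (Fin 3 → ℝ)).restrict T3) :=
  ⟨by rw [Measure.restrict_apply_univ]; exact T3_cpt.measure_lt_top⟩

lemma FF_deriv {g : (Fin 3 → ℝ) → ℂ} {N : ℝ} (hg : Good g N) {z : ℂ} (hz : 0 < z.im) :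
    HasDerivAt (FF g) (∫ p in T3, -(RR z p ^ 2 * g p)) z := by
  obtain ⟨hC, hP, hN, hN'⟩ := hg
  have := T3_fin
  have hcg := hC.continuous
  have hopen : IsOpen {w : ℂ | z.im / 2 < w.im} := isOpen_lt continuous_const Complex.continuous_im
  have hs : {w : ℂ | z.im / 2 < w.im} ∈ 𝓝 z := hopen.mem_nhds (by
    simp only [Set.mem_ofPred_eq]; linarith)
  refine (hasDerivAt_integral_of_dominated_loc_of_deriv_le (μ := volume.restrict T3)
    (F := fun z p => RR z p * g p) (F' := fun z p => -(RR z p ^ 2 * g p))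
    (bound := fun _ => ((z.im / 2)⁻¹) ^ 2 * N) hs ?_ ?_ ?_ ?_ ?_ ?_).2
  · filter_upwards [hs] with w hw
    have hw' : 0 < w.im := lt_trans (by linarith) (show z.im / 2 < w.im from hw)
    have := (RR_contDiff hw').continuous
    exact (this.mul hcg).aestronglyMeasurable
  · have := (RR_contDiff hz).continuous
    exact (this.mul hcg).continuousOn.integrableOn_compact T3_cpt
  · have := (RR_contDiff hz).continuous
    exact (by fun_prop : Continuous fun p => -(RR z p ^ 2 * g p)).aestronglyMeasurable
  · refine Eventually.of_forall fun p w hw => ?_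
    have hw1 : z.im / 2 < w.im := hw
    have hw' : 0 < w.im := lt_trans (by linarith) hw1
    rw [norm_neg, norm_mul, norm_pow]
    have h1 := RR_norm_im hw' p
    have h2 : (w.im)⁻¹ ≤ (z.im/2)⁻¹ := by gcongr
    gcongr
    · exact h1.trans h2
    · exact hN p
  · exact integrable_const _
  · refine Eventually.of_forall fun p w hw => ?_
    have hw1 : z.im / 2 < w.im := hw
    have hw' : 0 < w.im := lt_trans (by linarith) hw1
    have h := (((hasDerivAt_id w).sub_const (edisp p : ℂ)).inv (RR_ne hw' _)).mul_const (g p)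
    refine h.congr_deriv ?_
    simp [RR]
    ring

lemma FF_deriv_bound {g : (Fin 3 → ℝ) → ℂ} {N : ℝ} (hg : Good g N) {z : ℂ} (hz : 0 < z.im) (hz1 : z.im ≤ 1) :
    ‖∫ p in T3, -(RR z p ^ 2 * g p)‖ ≤ 400 * N * gd z.im := by
  rw [integral_neg, norm_neg]
  exact deriv_bound hz hz1 g hg.1 hg.2.1 N hg.2.2.1 hg.2.2.2

def gg (t : ℝ) : ℝ := 2 * Real.sqrt t * (3 - Real.log t)
def md (t : ℝ) : ℝ := Real.sqrt t * (1 - Real.log t)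

lemma gg_deriv {t : ℝ} (ht : 0 < t) : HasDerivAt gg (gd t) t := by
  have hs : 0 < Real.sqrt t := Real.sqrt_pos.2 ht
  have hsq : Real.sqrt t ^ 2 = t := Real.sq_sqrt ht.le
  have h := (((Real.hasDerivAt_sqrt ht.ne').const_mul 2).mul ((Real.hasDerivAt_log ht.ne').const_sub 3))
  refine HasDerivAt.congr_deriv (f := gg) h ?_
  unfold gd
  have : t⁻¹ = (Real.sqrt t ^ 2)⁻¹ := by rw [hsq]
  rw [this]
  field_simp
  ring

lemma gg_le {η h' h : ℝ} (hη : 0 < η) (h0 : 0 ≤ h') (hh : h' ≤ h) (hh0 : 0 < h) (h1 : η + h' ≤ 1) (hle : h ≤ 1) :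
    gg (η + h') - gg η ≤ gg h := by
  have hlh : Real.log h ≤ 0 := Real.log_nonpos hh0.le hle
  rcases h0.eq_or_lt with rfl | h0
  · simp only [add_zero, sub_self]
    unfold gg
    have := Real.sqrt_nonneg h
    have : 0 ≤ 3 - Real.log h := by linarith
    positivity
  have hs1 : Real.sqrt (η + h') ≤ Real.sqrt η + Real.sqrt h' := by
    rw [Real.sqrt_le_left (by positivity)]
    nlinarith [Real.sq_sqrt hη.le, Real.sq_sqrt h0.le, Real.sqrt_nonneg η, Real.sqrt_nonneg h', mul_nonneg (Real.sqrt_nonneg η) (Real.sqrt_nonneg h')]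
  have l1 : Real.log η ≤ Real.log (η + h') := Real.log_le_log hη (by linarith)
  have l2 : Real.log h' ≤ Real.log (η + h') := Real.log_le_log h0 (by linarith)
  have l3 : Real.log (η + h') ≤ 0 := Real.log_nonpos (by positivity) h1
  have hη0 := Real.sqrt_nonneg η
  have hh'0 := Real.sqrt_nonneg h'
  have step1 : gg (η + h') - gg η ≤ gg h' := by
    unfold gg
    have a1 : (Real.sqrt (η + h') - Real.sqrt η) * (3 - Real.log (η + h')) ≤ Real.sqrt h' * (3 - Real.log h') := by
      calc _ ≤ Real.sqrt h' * (3 - Real.log (η + h')) := by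
            apply mul_le_mul_of_nonneg_right <;> linarith
        _ ≤ _ := by apply mul_le_mul_of_nonneg_left <;> linarith
    nlinarith [mul_le_mul_of_nonneg_left l1 hη0]
  refine step1.trans ?_
  have hmono : MonotoneOn gg (Set.Ioc 0 1) := by
    apply monotoneOn_of_deriv_nonneg (convex_Ioc 0 1)
    · intro t ht; exact (gg_deriv ht.1).continuousAt.continuousWithinAt
    · intro t ht
      rw [interior_Ioc] at ht
      exact (gg_deriv ht.1).differentiableAt.differentiableWithinAt
    · intro t ht
      rw [interior_Ioc] at ht
      rw [(gg_deriv ht.1).deriv]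
      unfold gd
      have := Real.log_nonpos ht.1.le ht.2.le
      apply div_nonneg (by linarith) (Real.sqrt_nonneg _)
  exact hmono ⟨h0, hh.trans hle⟩ ⟨hh0, hle⟩ hh

lemma vert {g : (Fin 3 → ℝ) → ℂ} {N : ℝ} (hg : Good g N) (x : ℝ) {η h' h : ℝ} (hη : 0 < η) (h0 : 0 ≤ h')
    (hh : h' ≤ h) (hh0 : 0 < h) (h1 : η + h' ≤ 1) (hle : h ≤ 1) :
    ‖FF g ⟨x, η + h'⟩ - FF g ⟨x, η⟩‖ ≤ 400 * N * gg h := by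
  have hN0 : 0 ≤ N := (norm_nonneg _).trans (hg.2.2.1 0)
  have hd : ∀ t : ℝ, 0 < t → HasDerivAt (fun t : ℝ => FF g ⟨x, t⟩)
      ((∫ p in T3, -(RR ⟨x, t⟩ p ^ 2 * g p)) * Complex.I) t := by
    intro t ht
    have e : ∀ t : ℝ, (⟨x, t⟩ : ℂ) = (x : ℂ) + t * Complex.I := fun t => by
      apply Complex.ext <;> simp
    have h2 : HasDerivAt (fun t : ℝ => (⟨x, t⟩ : ℂ)) Complex.I t := by
      simp_rw [e]
      have := ((hasDerivAt_id t).ofReal_comp.mul_const Complex.I).const_add (x : ℂ)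
      simpa using this
    exact HasDerivAt.comp (h₂ := FF g) t (FF_deriv hg (z := ⟨x, t⟩) ht) h2
  have key := image_norm_le_of_norm_deriv_right_le_deriv_boundary' (a := η) (b := η + h')
    (f := fun t : ℝ => FF g ⟨x, t⟩ - FF g ⟨x, η⟩)
    (f' := fun t => (∫ p in T3, -(RR ⟨x, t⟩ p ^ 2 * g p)) * Complex.I)
    (B := fun t => 400 * N * (gg t - gg η)) (B' := fun t => 400 * N * gd t)
    (fun t ht => ((hd t (hη.trans_le ht.1)).sub_const _).continuousAt.continuousWithinAt)
    (fun t ht => ((hd t (hη.trans_le ht.1)).sub_const _).hasDerivWithinAt)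
    (by simp)
    (fun t ht => (((gg_deriv (hη.trans_le ht.1)).sub_const _).const_mul _).continuousAt.continuousWithinAt)
    (fun t ht => (((gg_deriv (hη.trans_le ht.1)).sub_const _).const_mul _).hasDerivWithinAt)
    (fun t ht => by
      rw [norm_mul, Complex.norm_I, mul_one]
      exact FF_deriv_bound hg (z := ⟨x, t⟩) (hη.trans_le ht.1) (ht.2.le.trans h1))
    (x := η + h') ⟨by linarith, le_rfl⟩
  refine key.trans ?_
  gcongr
  exact gg_le hη h0 hh hh0 h1 hle

lemma horiz {g : (Fin 3 → ℝ) → ℂ} {N : ℝ} (hg : Good g N) (x x' : ℝ) {η : ℝ} (hη : 0 < η) (h1 : η ≤ 1) :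
    ‖FF g ⟨x, η⟩ - FF g ⟨x', η⟩‖ ≤ 400 * N * gd η * |x - x'| := by
  have hd : ∀ t : ℝ, HasDerivAt (fun t : ℝ => FF g ⟨t, η⟩)
      (∫ p in T3, -(RR ⟨t, η⟩ p ^ 2 * g p)) t := by
    intro t
    have e : ∀ t : ℝ, (⟨t, η⟩ : ℂ) = (t : ℂ) + η * Complex.I := fun t => by
      apply Complex.ext <;> simp
    have h2 : HasDerivAt (fun t : ℝ => (⟨t, η⟩ : ℂ)) 1 t := by
      simp_rw [e]
      have := (hasDerivAt_id t).ofReal_comp.add_const (η * Complex.I)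
      simpa using this
    have := HasDerivAt.comp (h₂ := FF g) t (FF_deriv hg (z := ⟨t, η⟩) hη) h2
    rw [mul_one] at this
    exact this
  have := Convex.norm_image_sub_le_of_norm_hasDerivWithin_le (f := fun t : ℝ => FF g ⟨t, η⟩) (s := Set.univ)
    (C := 400 * N * gd η) (fun t _ => (hd t).hasDerivWithinAt)
    (fun t _ => FF_deriv_bound hg (z := ⟨t, η⟩) hη h1) convex_univ (Set.mem_univ x') (Set.mem_univ x)
  simpa using this

lemma gd_anti {a b : ℝ} (ha : 0 < a) (hab : a ≤ b) (hb : b ≤ 1) : gd b ≤ gd a := by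
  unfold gd
  have hs : 0 < Real.sqrt a := Real.sqrt_pos.2 ha
  have h1 := Real.log_le_log ha hab
  have h2 := Real.log_nonpos (ha.le.trans hab) hb
  have : 0 ≤ 1 - Real.log a := by linarith
  gcongr

lemma gg_md {h : ℝ} (h0 : 0 < h) (h1 : h ≤ 1) : gg h ≤ 6 * md h := by
  unfold gg md
  have := Real.log_nonpos h0.le h1
  nlinarith [Real.sqrt_nonneg h, mul_nonneg (Real.sqrt_nonneg h) (neg_nonneg.2 this)]

lemma modulus {g : (Fin 3 → ℝ) → ℂ} {N : ℝ} (hg : Good g N) (x y x' y' : ℝ) {h : ℝ} (hy : 0 < y) (hy' : 0 < y')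
    (hy1 : y ≤ 1/2) (h0 : 0 < h) (hle : h ≤ 1/2)
    (hx : |x - x'| ≤ h) (hyy : |y - y'| ≤ h) :
    ‖FF g ⟨x, y⟩ - FF g ⟨x', y'⟩‖ ≤ 10000 * N * md h := by
  have hN0 : 0 ≤ N := (norm_nonneg _).trans (hg.2.2.1 0)
  have hyy' := abs_le.1 hyy
  have a1 := vert hg x (η := y) (h' := h) (h := h) hy h0.le le_rfl h0 (by linarith) (by linarith)
  have a2 := horiz hg x x' (η := y + h) (by linarith) (by linarith)
  have a3 := vert hg x' (η := y') (h' := y + h - y') (h := 2 * h) hy' (by linarith) (by linarith)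
    (by linarith) (by linarith) (by linarith)
  rw [add_sub_cancel] at a3
  have hlog : Real.log h ≤ 0 := Real.log_nonpos h0.le (by linarith)
  have hm := gg_md h0 (by linarith)
  have hmd : 0 ≤ md h := by unfold md; apply mul_nonneg (Real.sqrt_nonneg _); linarith
  have b2 : gd (y + h) * |x - x'| ≤ md h := by
    calc _ ≤ gd h * h := by
          gcongr
          · unfold gd; apply div_nonneg (by linarith) (Real.sqrt_nonneg _)
          · exact gd_anti h0 (by linarith) (by linarith)
      _ = _ := by
          unfold gd md
          have hs : 0 < Real.sqrt h := Real.sqrt_pos.2 h0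
          rw [div_mul_eq_mul_div, div_eq_iff hs.ne']
          have := Real.mul_self_sqrt h0.le
          calc _ = (1 - Real.log h) * (Real.sqrt h * Real.sqrt h) := by rw [this]
            _ = _ := by ring
  have b3 : gg (2 * h) ≤ 2 * gg h := by
    unfold gg
    have l1 : Real.log h ≤ Real.log (2 * h) := Real.log_le_log h0 (by linarith)
    have l3 : Real.log (2 * h) ≤ 0 := Real.log_nonpos (by positivity) (by linarith)
    have s1 : Real.sqrt (2 * h) ≤ 2 * Real.sqrt h := by
      rw [Real.sqrt_le_left (by positivity), mul_pow, Real.sq_sqrt h0.le]; linarith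
    calc _ ≤ 2 * (2 * Real.sqrt h) * (3 - Real.log h) := by
          gcongr
          linarith
      _ = _ := by ring
  have e : FF g ⟨x, y⟩ - FF g ⟨x', y'⟩ = -(FF g ⟨x, y + h⟩ - FF g ⟨x, y⟩) +
      (FF g ⟨x, y + h⟩ - FF g ⟨x', y + h⟩) + (FF g ⟨x', y + h⟩ - FF g ⟨x', y'⟩) := by ring
  rw [e]
  have tri := norm_add₃_le (a := -(FF g ⟨x, y + h⟩ - FF g ⟨x, y⟩))
    (b := (FF g ⟨x, y + h⟩ - FF g ⟨x', y + h⟩)) (c := (FF g ⟨x', y + h⟩ - FF g ⟨x', y'⟩))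
  rw [norm_neg] at tri
  have c1 : 400 * N * gg h ≤ 400 * N * (6 * md h) := by gcongr
  have c2 : 400 * N * gd (y + h) * |x - x'| ≤ 400 * N * md h := by
    rw [mul_assoc]; gcongr
  have c3 : 400 * N * gg (2 * h) ≤ 400 * N * (2 * (6 * md h)) := by
    gcongr; linarith
  have : 0 ≤ N * md h := by positivity
  nlinarith

lemma one_good : Good (fun _ => 1) 1 := by
  refine ⟨contDiff_const, fun _ _ => rfl, fun _ => by simp, fun p => by simp⟩

lemma ThetaEps_eq (ε α : ℝ) : ThetaEps ε α = FF (fun _ => 1) ⟨α, ε⟩ := by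
  unfold ThetaEps FF RR
  congr 1
  ext p
  rw [mul_one]
  congr 1
  apply Complex.ext <;> simp

lemma T3_vol : (volume : Measure (Fin 3 → ℝ)).real T3 = 1 := by
  rw [T3_eq, Measure.real, Real.volume_Icc_pi]
  norm_num

lemma FF_one_bound (x : ℝ) {y : ℝ} (hy : 0 < y) (hy1 : y ≤ 1) : ‖FF (fun _ => 1) ⟨x, y⟩‖ ≤ 2401 := by
  have h1 := vert one_good x (η := y) (h' := 1 - y) (h := 1) hy (by linarith) (by linarith) one_pos
    (by linarith) le_rfl
  rw [add_sub_cancel] at h1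
  have h2 : ‖FF (fun _ => 1) ⟨x, 1⟩‖ ≤ 1 := by
    unfold FF
    have := norm_setIntegral_le_of_norm_le_const (μ := (volume : Measure (Fin 3 → ℝ))) (s := T3)
      (f := fun p => RR ⟨x, 1⟩ p * 1) (C := 1) T3_cpt.measure_lt_top (fun p _ => by
        rw [mul_one]
        have := RR_norm_im (z := ⟨x, 1⟩) one_pos p
        simpa using this)
    rw [T3_vol] at this
    simpa using this
  have h3 : gg 1 = 6 := by unfold gg; simp; norm_num
  rw [h3] at h1
  have := norm_sub_norm_le (FF (fun _ => 1) ⟨x, y⟩) (FF (fun _ => 1) ⟨x, 1⟩)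
  rw [norm_sub_rev] at this
  linarith

lemma Theta_bound {Θ : ℝ → ℂ} (hΘ : IsThetaLimit Θ) (a : ℝ) : ‖Θ a‖ ≤ 2401 := by
  refine le_of_tendsto (hΘ a).norm ?_
  filter_upwards [Ioc_mem_nhdsGT (zero_lt_one' ℝ)] with ε hε
  rw [ThetaEps_eq]
  exact FF_one_bound a hε.1 hε.2

lemma RR_im (x y : ℝ) (p : Fin 3 → ℝ) : (RR ⟨x, y⟩ p).im = -(y * ((x - edisp p) ^ 2 + y ^ 2)⁻¹) := by
  unfold RR
  rw [Complex.inv_im, Complex.normSq_apply]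
  simp
  ring

lemma FF_one_im (x : ℝ) {y : ℝ} (hy : 0 < y) :
    (FF (fun _ => 1) ⟨x, y⟩).im = -(y * ∫ p in T3, ((x - edisp p) ^ 2 + y ^ 2)⁻¹) := by
  unfold FF
  have hi : IntegrableOn (fun p => RR ⟨x, y⟩ p * 1) T3 :=
    ((RR_contDiff (z := ⟨x, y⟩) hy).continuous.mul continuous_const).continuousOn.integrableOn_compact T3_cpt
  have := Complex.imCLM.integral_comp_comm hi
  simp only [Complex.imCLM_apply] at this
  rw [← this, ← integral_const_mul, ← integral_neg]
  congr 1
  ext p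
  rw [mul_one, RR_im]

lemma Theta_im {Θ : ℝ → ℂ} (hΘ : IsThetaLimit Θ) (a : ℝ) : (Θ a).im ≤ 0 := by
  refine le_of_tendsto ((Complex.continuous_im.tendsto _).comp (hΘ a)) ?_
  filter_upwards [Ioc_mem_nhdsGT (zero_lt_one' ℝ)] with ε hε
  simp only [Function.comp]
  rw [ThetaEps_eq, FF_one_im a hε.1]
  have : 0 ≤ ∫ p in T3, ((a - edisp p) ^ 2 + ε ^ 2)⁻¹ := integral_nonneg fun p => by
    simp only [Pi.zero_apply]; positivity
  have := mul_nonneg hε.1.le this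
  linarith

lemma Theta_mod {Θ : ℝ → ℂ} (hΘ : IsThetaLimit Θ) (a b h : ℝ) (h0 : 0 < h) (hle : h ≤ 1/2) (hab : |a - b| ≤ h) :
    ‖Θ a - Θ b‖ ≤ 10000 * md h := by
  refine le_of_tendsto ((hΘ a).sub (hΘ b)).norm ?_
  filter_upwards [Ioc_mem_nhdsGT (show (0:ℝ) < 1/2 by norm_num)] with ε hε
  rw [ThetaEps_eq, ThetaEps_eq]
  have := modulus one_good a ε b ε hε.1 hε.1 hε.2 h0 hle hab (by simpa using h0.le)
  simpa using this

lemma cont_dos (b : ℝ) {η : ℝ} (hη : 0 < η) : Continuous fun p => ((b - edisp p) ^ 2 + η ^ 2)⁻¹ := by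
  have := edisp_cont
  exact Continuous.inv₀ (by fun_prop) (fun x => by positivity)

lemma cont_sq (b : ℝ) {η : ℝ} (hη : 0 < η) : Continuous fun p => (Real.sqrt ((b - edisp p) ^ 2 + η ^ 2))⁻¹ := by
  have := edisp_cont
  exact Continuous.inv₀ (by fun_prop) (fun x => by positivity)

lemma dos (b : ℝ) {η : ℝ} (hη : 0 < η) (hη1 : η ≤ 1) :
    ∫ p in T3, ((b - edisp p) ^ 2 + η ^ 2)⁻¹ ≤ 2401 / η := by
  rw [le_div_iff₀ hη]
  have h1 := FF_one_im b hη
  have h2 := FF_one_bound b hη hη1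
  have h3 := Complex.abs_im_le_norm (FF (fun _ => 1) ⟨b, η⟩)
  rw [h1, abs_neg] at h3
  have := (le_abs_self _).trans h3
  linarith

lemma sq_pt (x : ℝ) {δ : ℝ} (hδ : 0 < δ) : (Real.sqrt (x ^ 2 + δ ^ 2))⁻¹ ≤
    (Real.sqrt (x ^ 2 + (2 * δ) ^ 2))⁻¹ + 2 * δ * (x ^ 2 + δ ^ 2)⁻¹ := by
  have hA2 : Real.sqrt (x ^ 2 + δ ^ 2) ^ 2 = x ^ 2 + δ ^ 2 := Real.sq_sqrt (by positivity)
  have hB2 : Real.sqrt (x ^ 2 + (2 * δ) ^ 2) ^ 2 = x ^ 2 + (2 * δ) ^ 2 := Real.sq_sqrt (by positivity)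
  have hA : 0 < Real.sqrt (x ^ 2 + δ ^ 2) := by positivity
  have hB : 0 < Real.sqrt (x ^ 2 + (2 * δ) ^ 2) := by positivity
  have e0 : (x ^ 2 + δ ^ 2)⁻¹ = (Real.sqrt (x ^ 2 + δ ^ 2) ^ 2)⁻¹ := by rw [hA2]
  rw [e0]
  clear e0
  set A := Real.sqrt (x ^ 2 + δ ^ 2)
  set B := Real.sqrt (x ^ 2 + (2 * δ) ^ 2)
  have hAB : A ≤ B := by
    apply Real.sqrt_le_sqrt; nlinarith
  have hBA : B ≤ A + 2 * δ := by
    refine (sq_le_sq₀ hB.le (by positivity)).1 ?_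
    nlinarith
  have e : B⁻¹ + 2 * δ * (A^2)⁻¹ - A⁻¹ = (A * (A - B) + 2 * δ * B) / (A ^ 2 * B) := by
    field_simp
    ring
  have : 0 ≤ B⁻¹ + 2 * δ * (A^2)⁻¹ - A⁻¹ := by
    rw [e]
    apply div_nonneg _ (by positivity)
    nlinarith [mul_nonneg hA.le (sub_nonneg.2 hBA), mul_nonneg hδ.le (sub_nonneg.2 hAB)]
  linarith

lemma LL_step (b : ℝ) {δ : ℝ} (hδ : 0 < δ) (hδ1 : δ ≤ 1) :
    ∫ p in T3, (Real.sqrt ((b - edisp p) ^ 2 + δ ^ 2))⁻¹ ≤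
    (∫ p in T3, (Real.sqrt ((b - edisp p) ^ 2 + (2 * δ) ^ 2))⁻¹) + 4802 := by
  have hi1 : IntegrableOn (fun p => (Real.sqrt ((b - edisp p) ^ 2 + (2 * δ) ^ 2))⁻¹) T3 :=
    (cont_sq b (by positivity)).continuousOn.integrableOn_compact T3_cpt
  have hi2 : IntegrableOn (fun p => 2 * δ * ((b - edisp p) ^ 2 + δ ^ 2)⁻¹) T3 :=
    ((cont_dos b hδ).const_mul _).continuousOn.integrableOn_compact T3_cpt
  calc _ ≤ ∫ p in T3, ((Real.sqrt ((b - edisp p) ^ 2 + (2 * δ) ^ 2))⁻¹ + 2 * δ * ((b - edisp p) ^ 2 + δ ^ 2)⁻¹) := by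
        apply integral_mono ((cont_sq b hδ).continuousOn.integrableOn_compact T3_cpt) (hi1.add hi2)
        intro p
        exact sq_pt _ hδ
    _ ≤ _ := by
        rw [integral_add hi1 hi2, integral_const_mul]
        have := dos b hδ hδ1
        have : 2 * δ * ∫ p in T3, ((b - edisp p) ^ 2 + δ ^ 2)⁻¹ ≤ 2 * δ * (2401 / δ) := by gcongr
        have e : 2 * δ * (2401 / δ) = 4802 := by field_simp; norm_num
        linarith

lemma LL_pow (b : ℝ) (n : ℕ) :
    ∫ p in T3, (Real.sqrt ((b - edisp p) ^ 2 + ((1/2:ℝ)^n) ^ 2))⁻¹ ≤ 1 + 4802 * n := by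
  induction n with
  | zero =>
    have : ∫ p in T3, (Real.sqrt ((b - edisp p) ^ 2 + ((1/2:ℝ)^0) ^ 2))⁻¹ ≤ ∫ p in T3, (1:ℝ) := by
      apply integral_mono ((cont_sq b (by positivity)).continuousOn.integrableOn_compact T3_cpt)
      · exact continuous_const.continuousOn.integrableOn_compact T3_cpt
      · intro p
        simp only
        apply inv_le_one_of_one_le₀
        rw [Real.one_le_sqrt]
        nlinarith [sq_nonneg (b - edisp p)]
    refine this.trans ?_
    rw [setIntegral_const, T3_vol]
    simp
  | succ n ih =>
    have := LL_step b (δ := (1/2:ℝ)^(n+1)) (by positivity) (pow_le_one₀ (by norm_num) (by norm_num))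
    rw [show 2 * (1/2:ℝ)^(n+1) = (1/2)^n by rw [pow_succ]; ring] at this
    push_cast
    linarith

lemma LL (b : ℝ) {δ : ℝ} (hδ : 0 < δ) (hδ1 : δ ≤ 1) :
    ∫ p in T3, (Real.sqrt ((b - edisp p) ^ 2 + δ ^ 2))⁻¹ ≤ 10000 * (1 - Real.log δ) := by
  have hlog := Real.log_nonpos hδ.le hδ1
  set n := ⌈2 * (-Real.log δ)⌉₊ with hn
  have hn1 : (n : ℝ) < 2 * (-Real.log δ) + 1 := Nat.ceil_lt_add_one (by linarith)
  have hn2 : 2 * (-Real.log δ) ≤ n := Nat.le_ceil _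
  have hle : (1/2:ℝ)^n ≤ δ := by
    rw [← Real.log_le_log_iff (by positivity) hδ, Real.log_pow, one_div, Real.log_inv]
    have := Real.log_two_gt_d9
    nlinarith
  have hpos : (0:ℝ) < (1/2)^n := by positivity
  calc _ ≤ ∫ p in T3, (Real.sqrt ((b - edisp p) ^ 2 + ((1/2:ℝ)^n) ^ 2))⁻¹ := by
        apply integral_mono ((cont_sq b hδ).continuousOn.integrableOn_compact T3_cpt)
          ((cont_sq b hpos).continuousOn.integrableOn_compact T3_cpt)
        intro p
        simp only
        gcongr
    _ ≤ 1 + 4802 * n := LL_pow b n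
    _ ≤ _ := by nlinarith

lemma periodic_bdd {E : Type*} [NormedAddCommGroup E] (f : (Fin 3 → ℝ) → E) (hc : Continuous f)
    (hp : ∀ (p : Fin 3 → ℝ) (n : Fin 3 → ℤ), f (p + fun j => (n j : ℝ)) = f p) :
    BddAbove (Set.range fun p => ‖f p‖) := by
  obtain ⟨B, hB⟩ := T3_cpt.exists_bound_of_continuousOn hc.continuousOn
  refine ⟨B, ?_⟩
  rintro _ ⟨p, rfl⟩
  simp only
  rw [← hp p (fun j => -round (p j))]
  apply hB
  intro j _
  have := abs_le.1 (abs_sub_round (p j))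
  simp only [Pi.add_apply, Int.cast_neg, Set.mem_Icc]
  constructor <;> linarith [this.1, this.2]

lemma C1_good (g : (Fin 3 → ℝ) → ℂ) (hg : ContDiff ℝ 1 g) (hp : ZPeriodic g) : Good g (C1Norm g) := by
  have b1 := periodic_bdd g hg.continuous hp
  have b2 := periodic_bdd (fderiv ℝ g) (hg.continuous_fderiv one_ne_zero) (by
    intro p n
    rw [← fderiv_comp_add_right]
    congr 1
    ext q
    exact hp q n)
  have n1 : 0 ≤ ⨆ p : Fin 3 → ℝ, ‖g p‖ := Real.iSup_nonneg fun p => norm_nonneg _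
  have n2 : 0 ≤ ⨆ p : Fin 3 → ℝ, ‖fderiv ℝ g p‖ := Real.iSup_nonneg fun p => norm_nonneg _
  refine ⟨hg, hp, fun p => ?_, fun p => ?_⟩
  · have := le_ciSup b1 p
    unfold C1Norm
    linarith
  · have := le_ciSup b2 p
    unfold C1Norm
    linarith

/-- The shifted denominator. -/
def DD (x l η : ℝ) (w : ℂ) : ℂ := ⟨x - l ^ 2 * w.re, η - l ^ 2 * w.im⟩

lemma DD_im_le (x l : ℝ) {η : ℝ} {w : ℂ} (hη : 0 < η) (hw : w.im ≤ 0) : η ≤ ‖DD x l η w‖ := by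
  have := Complex.abs_im_le_norm (DD x l η w)
  have h2 := (le_abs_self _).trans this
  have : 0 ≤ l ^ 2 * (-w.im) := mul_nonneg (sq_nonneg _) (by linarith)
  simp only [DD] at h2 ⊢
  linarith

lemma DD_ne (x l : ℝ) {η : ℝ} {w : ℂ} (hη : 0 < η) (hw : w.im ≤ 0) : DD x l η w ≠ 0 := by
  have := DD_im_le x l hη hw
  exact norm_pos_iff.1 (hη.trans_le this)

lemma DD_sub (x l η : ℝ) (w v : ℂ) : DD x l η v - DD x l η w = (l : ℂ) ^ 2 * (w - v) := by
  apply Complex.ext <;> simp [DD, pow_two] <;> ring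

lemma DD_inv_sub (x l : ℝ) {η : ℝ} {w v : ℂ} (hη : 0 < η) (hw : w.im ≤ 0) (hv : v.im ≤ 0) :
    ‖(DD x l η w)⁻¹ - (DD x l η v)⁻¹‖ = l ^ 2 * ‖w - v‖ / (‖DD x l η w‖ * ‖DD x l η v‖) := by
  rw [inv_sub_inv (DD_ne x l hη hw) (DD_ne x l hη hv), DD_sub, norm_div, norm_mul, norm_mul, norm_pow,
    Complex.norm_real, Real.norm_eq_abs, sq_abs]

lemma case1 (x l : ℝ) {η : ℝ} {w v : ℂ} (hη : 0 < η) (hw : w.im ≤ 0) (hv : v.im ≤ 0)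
    (h : l ^ 2 * ‖w - v‖ ≤ η / 2) :
    ‖(DD x l η w)⁻¹ - (DD x l η v)⁻¹‖ ≤ 2 * (l ^ 2 * ‖w - v‖) * ((x - l ^ 2 * v.re) ^ 2 + η ^ 2)⁻¹ := by
  rw [DD_inv_sub x l hη hw hv]
  have h1 := DD_im_le x l hη hv
  have h2 : ‖DD x l η v‖ - ‖DD x l η w‖ ≤ l ^ 2 * ‖w - v‖ := by
    refine (norm_sub_norm_le _ _).trans ?_
    rw [DD_sub, norm_mul, norm_pow, Complex.norm_real, Real.norm_eq_abs, sq_abs]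
  have h3 : (x - l ^ 2 * v.re) ^ 2 + η ^ 2 ≤ ‖DD x l η v‖ ^ 2 := by
    rw [← Complex.normSq_eq_norm_sq, Complex.normSq_apply]
    simp only [DD]
    have : 0 ≤ l ^ 2 * (-v.im) := mul_nonneg (sq_nonneg _) (by linarith)
    nlinarith
  have hpos : 0 < (x - l ^ 2 * v.re) ^ 2 + η ^ 2 := by positivity
  have h4 : ((x - l ^ 2 * v.re) ^ 2 + η ^ 2) / 2 ≤ ‖DD x l η w‖ * ‖DD x l η v‖ := by
    nlinarith [norm_nonneg (DD x l η v)]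
  calc _ ≤ l ^ 2 * ‖w - v‖ / (((x - l ^ 2 * v.re) ^ 2 + η ^ 2) / 2) := by gcongr
    _ = _ := by field_simp

lemma DD_re_le (x l η : ℝ) {w : ℂ} (hw : ‖w‖ ≤ 2401) (hx : 4802 * l ^ 2 ≤ |x|) : |x| / 2 ≤ ‖DD x l η w‖ := by
  have h1 := Complex.abs_re_le_norm (DD x l η w)
  simp only [DD] at h1
  have h2 := abs_sub_abs_le_abs_sub x (l ^ 2 * w.re)
  have h3 : |l ^ 2 * w.re| ≤ l ^ 2 * 2401 := by
    rw [abs_mul, abs_of_nonneg (sq_nonneg l)]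
    gcongr
    exact (Complex.abs_re_le_norm w).trans hw
  simp only [DD]
  linarith

lemma case2 (x l : ℝ) {η : ℝ} {w v : ℂ} (hη : 0 < η) (hw : w.im ≤ 0) (hv : v.im ≤ 0)
    (hw' : ‖w‖ ≤ 2401) (hv' : ‖v‖ ≤ 2401) (hx : 4802 * l ^ 2 ≤ |x|) (hx0 : 0 < |x|) :
    ‖(DD x l η w)⁻¹ - (DD x l η v)⁻¹‖ ≤ 4 * l ^ 2 * ‖w - v‖ / |x| ^ 2 := by
  rw [DD_inv_sub x l hη hw hv]
  have h1 := DD_re_le x l η hw' hx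
  have h2 := DD_re_le x l η hv' hx
  calc _ ≤ l ^ 2 * ‖w - v‖ / ((|x| / 2) * (|x| / 2)) := by gcongr
    _ = _ := by field_simp; ring

lemma md_le {h l c : ℝ} (hl : 0 < l) (hL : 1 ≤ -Real.log l) (h1 : l ^ 2 ≤ h) (hc : Real.sqrt h ≤ c) :
    md h ≤ c * (3 * -Real.log l) := by
  unfold md
  have h2 : Real.log (l ^ 2) ≤ Real.log h := Real.log_le_log (by positivity) h1
  rw [Real.log_pow] at h2
  push_cast at h2
  have : 0 ≤ Real.sqrt h := Real.sqrt_nonneg h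
  calc _ ≤ Real.sqrt h * (3 * -Real.log l) := by gcongr; linarith
    _ ≤ _ := by gcongr

lemma pointwise {Θ : ℝ → ℂ} (hΘ : IsThetaLimit Θ) (a e : ℝ) {l η : ℝ} (hl : 0 < l) (hL : 1 ≤ -Real.log l)
    (hl1 : 4802 * l ^ 2 ≤ 1/2) (hη : 0 < η) (hs : 4200000 * l ^ 3 * (-Real.log l) ≤ η) :
    ‖(DD (a - e) l η (Θ e))⁻¹ - (DD (a - e) l η (Θ a))⁻¹‖ ≤
      4200000 * l ^ 3 * (-Real.log l) * ((a - l ^ 2 * (Θ a).re - e) ^ 2 + η ^ 2)⁻¹ +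
      360000 * l * (-Real.log l) * (Real.sqrt ((a - e) ^ 2 + (l ^ 2) ^ 2))⁻¹ + 76832 * l ^ 2 := by
  have t1 : 0 ≤ 4200000 * l ^ 3 * (-Real.log l) * ((a - l ^ 2 * (Θ a).re - e) ^ 2 + η ^ 2)⁻¹ := by
    have : 0 ≤ -Real.log l := by linarith
    positivity
  have t2 : 0 ≤ 360000 * l * (-Real.log l) * (Real.sqrt ((a - e) ^ 2 + (l ^ 2) ^ 2))⁻¹ := by
    have : 0 ≤ -Real.log l := by linarith
    positivity
  have t3 : 0 ≤ 76832 * l ^ 2 := by positivity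
  have i1 := Theta_im hΘ e
  have i2 := Theta_im hΘ a
  have n1 := Theta_bound hΘ e
  have n2 := Theta_bound hΘ a
  rcases le_total |a - e| (4802 * l ^ 2) with hx | hx
  · have hm := Theta_mod hΘ e a (4802 * l ^ 2) (by positivity) hl1 (by rwa [abs_sub_comm])
    have hmd := md_le (h := 4802 * l ^ 2) (c := 70 * l) hl hL (by nlinarith [sq_nonneg l]) (by
      rw [Real.sqrt_le_left (by positivity)]
      nlinarith [sq_nonneg l])
    have h3 : ‖Θ e - Θ a‖ ≤ 2100000 * l * (-Real.log l) := by linarith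
    have h4 : l ^ 2 * ‖Θ e - Θ a‖ ≤ 2100000 * l ^ 3 * (-Real.log l) := by
      calc _ ≤ l ^ 2 * (2100000 * l * (-Real.log l)) := by gcongr
        _ = _ := by ring
    have := case1 (a - e) l hη i1 i2 (by linarith)
    have e1 : a - e - l ^ 2 * (Θ a).re = a - l ^ 2 * (Θ a).re - e := by ring
    rw [e1] at this
    have h5 : 2 * (l ^ 2 * ‖Θ e - Θ a‖) * ((a - l ^ 2 * (Θ a).re - e) ^ 2 + η ^ 2)⁻¹ ≤
      4200000 * l ^ 3 * (-Real.log l) * ((a - l ^ 2 * (Θ a).re - e) ^ 2 + η ^ 2)⁻¹ := by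
      apply mul_le_mul_of_nonneg_right _ (by positivity)
      linarith
    linarith
  · have hx0 : 0 < |a - e| := lt_of_lt_of_le (by positivity) hx
    have hc := case2 (a - e) l hη i1 i2 n1 n2 hx hx0
    rcases le_total |a - e| (1/2) with hx2 | hx2
    · have hm := Theta_mod hΘ e a |a - e| hx0 hx2 (by rw [abs_sub_comm])
      have hmd := md_le (h := |a - e|) (c := Real.sqrt |a - e|) hl hL (by nlinarith [sq_nonneg l]) le_rfl
      set s := Real.sqrt |a - e| with hs'
      have hss : s ^ 2 = |a - e| := Real.sq_sqrt hx0.le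
      have hsl : l ≤ s := Real.le_sqrt_of_sq_le (by nlinarith [sq_nonneg l])
      have hs0 : 0 < s := hl.trans_le hsl
      have hq : Real.sqrt ((a - e) ^ 2 + (l ^ 2) ^ 2) ≤ 2 * |a - e| := by
        rw [Real.sqrt_le_left (by positivity), mul_pow, sq_abs, ← sq_abs (a - e)]
        nlinarith [sq_nonneg l]
      have hq0 : 0 < Real.sqrt ((a - e) ^ 2 + (l ^ 2) ^ 2) := by positivity
      have : 4 * l ^ 2 * ‖Θ e - Θ a‖ / |a - e| ^ 2 ≤
          360000 * l * (-Real.log l) * (Real.sqrt ((a - e) ^ 2 + (l ^ 2) ^ 2))⁻¹ := by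
        calc _ ≤ 4 * l ^ 2 * (10000 * (s * (3 * -Real.log l))) / |a - e| ^ 2 := by gcongr; linarith
          _ = 120000 * (l * (-Real.log l)) * (l / s * |a - e|⁻¹) := by
            rw [← hss]; field_simp; ring
          _ ≤ 120000 * (l * (-Real.log l)) * (1 * (2 * (Real.sqrt ((a - e) ^ 2 + (l ^ 2) ^ 2))⁻¹)) := by
            have : 0 ≤ -Real.log l := by linarith
            gcongr
            · exact div_le_one_of_le₀ hsl hs0.le
            · rw [inv_le_iff_one_le_mul₀ hx0]
              rw [← div_eq_mul_inv, div_mul_eq_mul_div, le_div_iff₀ hq0]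
              linarith
          _ ≤ _ := by
            have : 0 ≤ l * (-Real.log l) * (Real.sqrt ((a - e) ^ 2 + (l ^ 2) ^ 2))⁻¹ := by
              have : 0 ≤ -Real.log l := by linarith
              positivity
            linarith
      linarith
    · have : 4 * l ^ 2 * ‖Θ e - Θ a‖ / |a - e| ^ 2 ≤ 76832 * l ^ 2 := by
        have h5 : ‖Θ e - Θ a‖ ≤ 4802 := (norm_sub_le _ _).trans (by linarith)
        calc _ ≤ 4 * l ^ 2 * 4802 / (1/2) ^ 2 := by gcongr
          _ = _ := by ring
      linarith

lemma scalars {κ l η : ℝ} (hκ0 : 0 < κ) (hκ : κ ≤ 1/12) (hl : 0 < l) (hl0 : l ≤ 1 / 10 ^ 24)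
    (h1 : l ^ (2 + 4 * κ) ≤ η) (h2 : η ≤ l ^ (2 + κ)) :
    0 < η ∧ η ≤ 1/2 ∧ 1 ≤ -Real.log l ∧ 4200000 * l ^ 3 * (-Real.log l) ≤ η ∧
    l ^ 3 / η ≤ l ^ (1 - 4 * κ) ∧ l * (-Real.log l) ≤ l ^ (1 - 4 * κ) / (4 * κ) ∧ l ≤ l ^ (1 - 4 * κ) := by
  have hlone : l ≤ 1 := hl0.trans (by norm_num)
  have hη : 0 < η := lt_of_lt_of_le (Real.rpow_pos_of_pos hl _) h1
  have hL : 1 ≤ -Real.log l := by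
    rw [← Real.log_inv, Real.le_log_iff_exp_le (by positivity)]
    have := Real.exp_one_lt_d9
    have : (10 ^ 24 : ℝ) ≤ l⁻¹ := by
      rw [le_inv_comm₀ (by positivity) hl]
      simpa using hl0
    linarith
  have hX : l ^ (1 - 4 * κ) * l ^ (4 * κ) = l := by
    rw [← Real.rpow_add hl]; simp
  have hA : l ^ (2 + 4 * κ) = l ^ 2 * l ^ (4 * κ) := by
    rw [Real.rpow_add hl, Real.rpow_two]
  have hX0 : 0 < l ^ (1 - 4 * κ) := Real.rpow_pos_of_pos hl _
  have hY0 : 0 < l ^ (4 * κ) := Real.rpow_pos_of_pos hl _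
  have hY1 : l ^ (4 * κ) ≤ 1 := Real.rpow_le_one hl.le hlone (by linarith)
  refine ⟨hη, ?_, hL, ?_, ?_, ?_, ?_⟩
  · have : l ^ (2 + κ) ≤ l ^ (1 : ℝ) := Real.rpow_le_rpow_of_exponent_ge hl hlone (by linarith)
    rw [Real.rpow_one] at this
    have : (1:ℝ) / 10 ^ 24 ≤ 1/2 := by norm_num
    linarith
  · refine le_trans ?_ h1
    rw [hA]
    obtain ⟨m, hm, hm3⟩ : ∃ m : ℝ, 0 < m ∧ l ^ (1/3 : ℝ) = m := ⟨_, Real.rpow_pos_of_pos hl _, rfl⟩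
    have hlm : l = m ^ 3 := by
      rw [← hm3, ← Real.rpow_natCast, ← Real.rpow_mul hl.le]; norm_num
    have hY : m ≤ l ^ (4 * κ) := by
      rw [← hm3]
      exact Real.rpow_le_rpow_of_exponent_ge hl hlone (by linarith)
    have hm8 : m ≤ 1 / 10 ^ 8 := by
      refine le_of_pow_le_pow_left₀ (n := 3) (by norm_num) (by positivity) ?_
      rw [← hlm]
      refine hl0.trans ?_
      norm_num
    have hlog : -Real.log l ≤ 3 / m := by
      have := Real.log_le_sub_one_of_pos (inv_pos.2 hm)
      rw [Real.log_inv] at this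
      rw [hlm, Real.log_pow, div_eq_mul_inv]
      push_cast
      linarith
    calc 4200000 * l ^ 3 * (-Real.log l) ≤ 4200000 * l ^ 3 * (3 / m) := by gcongr
      _ = l ^ 2 * (12600000 * m * m) := by
        rw [hlm]; field_simp; ring
      _ ≤ l ^ 2 * (1 * m) := by
        gcongr
        have : (1:ℝ) / 10 ^ 8 * 12600000 ≤ 1 := by norm_num
        linarith
      _ ≤ _ := by rw [one_mul]; gcongr
  · rw [div_le_iff₀ hη]
    calc l ^ 3 = l ^ (1 - 4 * κ) * (l ^ 2 * l ^ (4 * κ)) := by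
          rw [mul_left_comm, hX]; ring
      _ ≤ _ := by rw [← hA]; gcongr
  · have := Real.log_le_sub_one_of_pos (inv_pos.2 hY0)
    rw [Real.log_inv, Real.log_rpow hl] at this
    have h5 : 4 * κ * (-Real.log l) ≤ (l ^ (4 * κ))⁻¹ := by linarith
    rw [le_div_iff₀ (by positivity)]
    calc l * (-Real.log l) * (4 * κ) = l * (4 * κ * (-Real.log l)) := by ring
      _ ≤ l * (l ^ (4 * κ))⁻¹ := by gcongr
      _ = _ := by
        nth_rewrite 1 [← hX]
        field_simp
  · nth_rewrite 1 [← hX]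
    exact mul_le_of_le_one_right hX0.le hY1

lemma partB {Θ : ℝ → ℂ} (hΘ : IsThetaLimit Θ) {g : (Fin 3 → ℝ) → ℂ} {N : ℝ} (hg : Good g N) (a : ℝ) {l η : ℝ}
    (hl : 0 < l) (hL : 1 ≤ -Real.log l)
    (hl1 : 4802 * l ^ 2 ≤ 1/2) (hη : 0 < η) (hη1 : η ≤ 1/2) :
    ‖FF g ⟨a, η⟩ - FF g ⟨a - l ^ 2 * (Θ a).re, η - l ^ 2 * (Θ a).im⟩‖ ≤ 1500000 * (l * (-Real.log l)) * N := by
  have hN : 0 ≤ N := (norm_nonneg _).trans (hg.2.2.1 0)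
  have i2 := Theta_im hΘ a
  have n2 := Theta_bound hΘ a
  have hr := (Complex.abs_re_le_norm (Θ a)).trans n2
  have hi := (Complex.abs_im_le_norm (Θ a)).trans n2
  have := modulus hg a η (a - l ^ 2 * (Θ a).re) (η - l ^ 2 * (Θ a).im) (h := 2401 * l ^ 2) hη
    (by nlinarith [mul_nonneg (sq_nonneg l) (neg_nonneg.2 i2)]) hη1 (by positivity) (by nlinarith [sq_nonneg l])
    (by
      rw [sub_sub_cancel, abs_mul, abs_of_nonneg (sq_nonneg l), mul_comm]
      gcongr)
    (by
      rw [sub_sub_cancel, abs_mul, abs_of_nonneg (sq_nonneg l), mul_comm]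
      gcongr)
  have hmd := md_le (h := 2401 * l ^ 2) (c := 50 * l) hl hL (by nlinarith [sq_nonneg l]) (by
      rw [Real.sqrt_le_left (by positivity)]
      nlinarith [sq_nonneg l])
  calc _ ≤ _ := this
    _ ≤ 10000 * N * (50 * l * (3 * -Real.log l)) := by gcongr
    _ = _ := by ring

lemma main_bound {Θ : ℝ → ℂ} (hΘ : IsThetaLimit Θ) {g : (Fin 3 → ℝ) → ℂ} {N : ℝ} (hg : Good g N) (a : ℝ)
    {l η : ℝ} (hl : 0 < l) (hl2 : l ≤ 1) (hL : 1 ≤ -Real.log l)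
    (hl1 : 4802 * l ^ 2 ≤ 1/2) (hη : 0 < η) (hη1 : η ≤ 1/2) (hs : 4200000 * l ^ 3 * (-Real.log l) ≤ η) :
    ‖∫ p in T3, ((DD (a - edisp p) l η (Θ (edisp p)))⁻¹ - RR ⟨a, η⟩ p) * g p‖ ≤
      (4200000 * l ^ 3 * (-Real.log l) * (2401 / η) +
      360000 * l * (-Real.log l) * (10000 * (1 - Real.log (l ^ 2))) + 76832 * l ^ 2) * N
      + 1500000 * (l * (-Real.log l)) * N := by
  have hN : 0 ≤ N := (norm_nonneg _).trans (hg.2.2.1 0)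
  have hL0 : 0 ≤ -Real.log l := by linarith
  have hlog2 : 0 ≤ 1 - Real.log (l ^ 2) := by
    rw [Real.log_pow]; push_cast; linarith
  have i2 := Theta_im hΘ a
  have hy' : 0 < η - l ^ 2 * (Θ a).im := by nlinarith [mul_nonneg (sq_nonneg l) (neg_nonneg.2 i2)]
  set z : ℂ := ⟨a, η⟩ with hz
  set z' : ℂ := ⟨a - l ^ 2 * (Θ a).re, η - l ^ 2 * (Θ a).im⟩ with hz'
  have eRR : ∀ p, RR z' p = (DD (a - edisp p) l η (Θ a))⁻¹ := by
    intro p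
    unfold RR DD
    congr 1
    apply Complex.ext <;> simp [hz'] <;> ring
  have c1 : IntegrableOn (fun p => RR z p * g p) T3 :=
    ((RR_contDiff (z := z) hη).continuous.mul hg.1.continuous).continuousOn.integrableOn_compact T3_cpt
  have c2 : IntegrableOn (fun p => RR z' p * g p) T3 :=
    ((RR_contDiff (z := z') hy').continuous.mul hg.1.continuous).continuousOn.integrableOn_compact T3_cpt
  by_cases hA : IntegrableOn (fun p => ((DD (a - edisp p) l η (Θ (edisp p)))⁻¹ - RR z' p) * g p) T3
  · have esplit : ∫ p in T3, ((DD (a - edisp p) l η (Θ (edisp p)))⁻¹ - RR z p) * g p =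
        (∫ p in T3, ((DD (a - edisp p) l η (Θ (edisp p)))⁻¹ - RR z' p) * g p) - (FF g z - FF g z') := by
      unfold FF
      rw [← integral_sub c1 c2]
      refine Eq.trans ?_ (integral_sub hA (c1.sub c2))
      congr 1
      ext p
      ring
    rw [esplit]
    refine (norm_sub_le _ _).trans ?_
    refine add_le_add ?_ (partB hΘ hg a hl hL hl1 hη hη1)
    set G : (Fin 3 → ℝ) → ℝ := fun p =>
      (4200000 * l ^ 3 * (-Real.log l) * ((a - l ^ 2 * (Θ a).re - edisp p) ^ 2 + η ^ 2)⁻¹ +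
      360000 * l * (-Real.log l) * (Real.sqrt ((a - edisp p) ^ 2 + (l ^ 2) ^ 2))⁻¹) + 76832 * l ^ 2 with hG
    have g1 : IntegrableOn (fun p => 4200000 * l ^ 3 * (-Real.log l) * ((a - l ^ 2 * (Θ a).re - edisp p) ^ 2 + η ^ 2)⁻¹) T3 :=
      ((cont_dos _ hη).const_mul _).continuousOn.integrableOn_compact T3_cpt
    have g2 : IntegrableOn (fun p => 360000 * l * (-Real.log l) * (Real.sqrt ((a - edisp p) ^ 2 + (l ^ 2) ^ 2))⁻¹) T3 :=
      ((cont_sq a (η := l ^ 2) (by positivity)).const_mul _).continuousOn.integrableOn_compact T3_cpt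
    have g3 : IntegrableOn (fun _ : Fin 3 → ℝ => 76832 * l ^ 2) T3 :=
      continuous_const.continuousOn.integrableOn_compact T3_cpt
    have g12 := g1.add g2
    have hGi : IntegrableOn G T3 := g12.add g3
    have b1 : ‖∫ p in T3, ((DD (a - edisp p) l η (Θ (edisp p)))⁻¹ - RR z' p) * g p‖ ≤ ∫ p in T3, G p * N := by
      refine norm_integral_le_of_norm_le (hGi.mul_const N) (Eventually.of_forall fun p => ?_)
      rw [norm_mul, eRR]
      have := pointwise hΘ a (edisp p) hl hL hl1 hη hs
      exact mul_le_mul this (hg.2.2.1 p) (norm_nonneg _) ((norm_nonneg _).trans this)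
    refine b1.trans ?_
    rw [integral_mul_const]
    have e1 : ∫ p in T3, G p = 4200000 * l ^ 3 * (-Real.log l) * (∫ p in T3, ((a - l ^ 2 * (Θ a).re - edisp p) ^ 2 + η ^ 2)⁻¹)
        + 360000 * l * (-Real.log l) * (∫ p in T3, (Real.sqrt ((a - edisp p) ^ 2 + (l ^ 2) ^ 2))⁻¹) + 76832 * l ^ 2 := by
      refine (integral_add g12 g3).trans ?_
      have e2 := integral_add g1 g2
      simp only [Pi.add_apply]
      rw [e2, integral_const_mul, integral_const_mul, setIntegral_const, T3_vol, one_smul]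
    rw [e1]
    have d1 := dos (a - l ^ 2 * (Θ a).re) hη (by linarith)
    have d2 := LL a (δ := l ^ 2) (by positivity) (pow_le_one₀ hl.le hl2)
    gcongr
  · rw [integral_undef, norm_zero]
    · positivity
    · intro hI
      apply hA
      have := (Integrable.add hI c1).sub c2
      refine this.congr (Eventually.of_forall fun p => ?_)
      simp only [Pi.sub_apply, Pi.add_apply]
      ring

/-- For `0 < κ ≤ 1/12` there are `C > 0`, `λ₀ > 0` such that for
`0 < λ ≤ λ₀`, `λ^{2+4κ} ≤ η ≤ λ^{2+κ}`, every `α ∈ ℝ` and every `C¹` function `g` on `𝕋³`,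
`|∫ [1/(α - ω(p) + iη) - 1/(α - e(p) + iη)] g(p) dp| ≤ C λ^{1-4κ} |log λ| ‖g‖_{C¹}`. -/
theorem statement2 (κ : ℝ) (hκ0 : 0 < κ) (hκ : κ ≤ 1/12) :
    ∃ C lam0 : ℝ, 0 < C ∧ 0 < lam0 ∧
      ∀ Θ : ℝ → ℂ, IsThetaLimit Θ →
        ∀ lam : ℝ, 0 < lam → lam ≤ lam0 →
          ∀ η : ℝ, lam ^ (2 + 4 * κ) ≤ η → η ≤ lam ^ (2 + κ) →
            ∀ α : ℝ, ∀ g : (Fin 3 → ℝ) → ℂ, ContDiff ℝ 1 g → ZPeriodic g →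
              ‖∫ p in T3,
                  (((α : ℂ) - omegaR Θ lam p + (η : ℂ) * Complex.I)⁻¹ -
                    ((α : ℂ) - (edisp p : ℂ) + (η : ℂ) * Complex.I)⁻¹) * g p‖ ≤
                C * lam ^ (1 - 4 * κ) * |Real.log lam| * C1Norm g := by
  refine ⟨4200000 * 2401 + 360000 * 30000 * (1 / (4 * κ)) + 76832 + 1500000, 1 / 10 ^ 24, by positivity,
    by positivity, ?_⟩
  intro Θ hΘ l hl hl0 η h1 h2 a g hg hp
  obtain ⟨hη, hη1, hL, hs, s1, s2, s3⟩ := scalars hκ0 hκ hl hl0 h1 h2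
  have hG := C1_good g hg hp
  have hN : 0 ≤ C1Norm g := (norm_nonneg _).trans (hG.2.2.1 0)
  have hl2 : l ≤ 1 := hl0.trans (by norm_num)
  have hl1 : 4802 * l ^ 2 ≤ 1/2 := by
    have : (1:ℝ) / 10 ^ 24 ≤ 1 / 9604 := by norm_num
    nlinarith
  have hm := main_bound hΘ hG a hl hl2 hL hl1 hη hη1 hs
  have e : ∀ p, ((a : ℂ) - omegaR Θ l p + (η : ℂ) * Complex.I)⁻¹ -
      ((a : ℂ) - (edisp p : ℂ) + (η : ℂ) * Complex.I)⁻¹ =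
      (DD (a - edisp p) l η (Θ (edisp p)))⁻¹ - RR ⟨a, η⟩ p := by
    intro p
    unfold RR DD omegaR
    congr 2
    · apply Complex.ext <;>
        simp [pow_two] <;> ring
    · apply Complex.ext <;> simp
  simp only [e]
  refine hm.trans ?_
  rw [abs_of_neg (by linarith)]
  set X := l ^ (1 - 4 * κ)
  have hX : 0 ≤ X := hl.le.trans s3
  rw [← add_mul]
  apply mul_le_mul_of_nonneg_right _ hN
  set L := -Real.log l with hLdef
  have hL0 : 0 ≤ L := by linarith
  have a1 : 4200000 * l ^ 3 * L * (2401 / η) ≤ 4200000 * 2401 * (X * L) := by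
    calc _ = 4200000 * 2401 * (l ^ 3 / η * L) := by ring
      _ ≤ _ := by gcongr
  have a2 : 360000 * l * L * (10000 * (1 - Real.log (l ^ 2))) ≤ 360000 * 30000 * (1 / (4 * κ)) * (X * L) := by
    have : 1 - Real.log (l ^ 2) ≤ 3 * L := by
      rw [Real.log_pow]; push_cast; linarith
    calc _ ≤ 360000 * l * L * (10000 * (3 * L)) := by gcongr
      _ = 360000 * 30000 * ((l * L) * L) := by ring
      _ ≤ 360000 * 30000 * ((X / (4 * κ)) * L) := by gcongr
      _ = _ := by ring
  have hlL : l * L ≤ X * L := by gcongr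
  have a3 : l ^ 2 ≤ X * L := by nlinarith
  linarith

end
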